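/- arXiv:1304.1237 — 4 statements merged into one kernel-verified Lean document; each statement's English description precedes it below -/
import Mathlib

section
/- Let n and r be integers with 2 ≤ r ≤ n and n ≥ 3, and let K be a field. Then the toric ideal I_{A_{n,r}} of the (n,r)-Birkhoff model is generated by the binomials it contains of degree at most three; that is, I_{A_{n,r}} is generated by the set of its elements of the form m₁ − m₂, where m₁ and m₂ are monomials in the variables p(σ) of equal degree at most three. -/
/-- The monomial map `π_{n,r}` of the `(n,r)`-Birkhoff model:
`p(σ) ↦ ∏_{j=1}^r ψ_{j,σ(j)}`. -/
noncomputable def birkhoffHom (n r : ℕ) (K : Type) [Field K] :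
    MvPolynomial (Fin r ↪ Fin n) K →ₐ[K] MvPolynomial (Fin r × Fin n) K :=
  MvPolynomial.aeval fun σ => ∏ j : Fin r, MvPolynomial.X (j, σ j)

/-- The toric ideal `I_{A_{n,r}}` of the `(n,r)`-Birkhoff model: the kernel of `π_{n,r}`. -/
noncomputable def toricIdeal (n r : ℕ) (K : Type) [Field K] :
    Ideal (MvPolynomial (Fin r ↪ Fin n) K) :=
  RingHom.ker (birkhoffHom n r K)

section Birkhoff
open Equiv Finset

variable {α : Type*} [DecidableEq α]

/-- The sum of the permutation matrices of a multiset of permutations. -/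
def permCount (S : Multiset (Perm α)) : Matrix α α ℤ :=
  (S.map fun σ => σ.permMatrix ℤ).sum

theorem permMatrix_eq_ite (σ : Perm α) (i j : α) :
    σ.permMatrix ℤ i j = if σ i = j then 1 else 0 := by
  simp [PEquiv.toMatrix_apply, Equiv.toPEquiv_apply]

@[simp]
theorem permCount_zero : permCount (0 : Multiset (Perm α)) = 0 := rfl

@[simp]
theorem permCount_cons (σ : Perm α) (S : Multiset (Perm α)) :
    permCount (σ ::ₘ S) = σ.permMatrix ℤ + permCount S := by
  simp [permCount]

@[simp]
theorem permCount_add (S T : Multiset (Perm α)) :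
    permCount (S + T) = permCount S + permCount T := by
  simp [permCount]

theorem permCount_apply (S : Multiset (Perm α)) (i j : α) :
    permCount S i j = S.countP fun σ => σ i = j := by
  induction S using Multiset.induction_on with
  | empty => simp
  | cons σ S ih =>
    rw [permCount_cons, Matrix.add_apply, ih, permMatrix_eq_ite, Multiset.countP_cons]
    push_cast
    ring

theorem permCount_nonneg (S : Multiset (Perm α)) (i j : α) : 0 ≤ permCount S i j := by
  rw [permCount_apply]
  positivity

theorem permCount_pos_iff {S : Multiset (Perm α)} {i j : α} :
    0 < permCount S i j ↔ ∃ σ ∈ S, σ i = j := by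
  rw [permCount_apply, Nat.cast_pos, Multiset.countP_pos]

theorem permMatrix_mul_swap (σ : Perm α) (x z : α) :
    (σ * swap x z).permMatrix ℤ = σ.permMatrix ℤ - Matrix.single x (σ x) 1
      - Matrix.single z (σ z) 1 + Matrix.single x (σ z) 1 + Matrix.single z (σ x) 1 := by
  ext i j
  simp only [permMatrix_eq_ite, Matrix.add_apply, Matrix.sub_apply, Matrix.single_apply,
    Perm.mul_apply, swap_apply_def]
  grind

variable [Fintype α]

theorem sum_permCount_row (S : Multiset (Perm α)) (i : α) :
    ∑ j, permCount S i j = S.card := by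
  induction S using Multiset.induction_on with
  | empty => simp
  | cons σ S ih => simp [sum_add_distrib, ih, add_comm]

theorem sum_permCount_col (S : Multiset (Perm α)) (j : α) :
    ∑ i, permCount S i j = S.card := by
  induction S using Multiset.induction_on with
  | empty => simp
  | cons σ S ih =>
    simp [sum_add_distrib, ih, add_comm, ← Equiv.eq_symm_apply]

/-- A nonnegative matrix with positive constant row and column sums has a permutation in its
support. -/
theorem exists_perm_forall_pos {M : α → α → ℤ} {k : ℕ} (hk : 0 < k) (h0 : ∀ i j, 0 ≤ M i j)
    (hrow : ∀ i, ∑ j, M i j = k) (hcol : ∀ j, ∑ i, M i j = k) :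
    ∃ σ : Perm α, ∀ i, 0 < M i (σ i) := by
  let f (i : α) : Finset α := {j | M i j ≠ 0}
  have hf (A : Finset α) : #A ≤ #(A.biUnion f) := by
    have (i : α) : ∑ j ∈ f i, M i j = k := by rw [← hrow i, sum_filter_ne_zero]
    have h₁ : ∑ i ∈ A, ∑ j ∈ f i, M i j = #A * k := by simp [this]
    have h₂ : ∑ i, ∑ j ∈ A.biUnion f, M i j = #(A.biUnion f) * k := by
      rw [sum_comm]
      simp [hcol]
    suffices (#A : ℤ) * k ≤ #(A.biUnion f) * k by
      exact_mod_cast le_of_mul_le_mul_right this (by exact_mod_cast hk)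
    rw [← h₁, ← h₂]
    trans ∑ i ∈ A, ∑ j ∈ A.biUnion f, M i j
    · exact sum_le_sum fun i hi =>
        sum_le_sum_of_subset_of_nonneg (subset_biUnion_of_mem f hi) (by simp [h0])
    · exact sum_le_sum_of_subset_of_nonneg (by simp) fun _ _ _ => sum_nonneg fun j _ => h0 _ _
  obtain ⟨g, hg, hg'⟩ := (all_card_le_biUnion_card_iff_exists_injective f).1 hf
  rw [Finite.injective_iff_bijective] at hg
  exact ⟨Equiv.ofBijective g hg, fun i => lt_of_le_of_ne (h0 _ _) (mem_filter_univ _ |>.1 (hg' i)).symm⟩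

/-- A nonnegative integer matrix with constant row and column sums `k` is a sum of `k`
permutation matrices. -/
theorem exists_permCount_eq {k : ℕ} {M : Matrix α α ℤ} (h0 : ∀ i j, 0 ≤ M i j)
    (hrow : ∀ i, ∑ j, M i j = k) (hcol : ∀ j, ∑ i, M i j = k) :
    ∃ S : Multiset (Perm α), S.card = k ∧ permCount S = M := by
  induction k generalizing M with
  | zero =>
    refine ⟨0, rfl, ?_⟩
    ext i j
    have := (sum_eq_zero_iff_of_nonneg fun j _ => h0 i j).1 (by simpa using hrow i) j (mem_univ j)
    simp [this]
  | succ k ih =>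
    obtain ⟨σ, hσ⟩ := exists_perm_forall_pos (M := M) k.succ_pos h0 hrow hcol
    obtain ⟨S, hS, hSM⟩ := ih (M := M - σ.permMatrix ℤ)
      (fun i j => by
        rw [Matrix.sub_apply, permMatrix_eq_ite]
        split_ifs with h
        · have := hσ i
          rw [h] at this
          lia
        · simpa using h0 i j)
      (fun i => by simp [hrow])
      (fun j => by simp [hcol, ← Equiv.eq_symm_apply])
    exact ⟨σ ::ₘ S, by simp [hS], by simp [hSM]⟩

/-- Exchange of the entries `(u, σ u)` and `(z, τ z)` of a pair of permutations. -/
theorem exists_permCount_exchange (σ τ : Perm α) (u z : α) :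
    ∃ S : Multiset (Perm α), S.card = 2 ∧
      permCount S = σ.permMatrix ℤ + τ.permMatrix ℤ - Matrix.single u (σ u) 1
        - Matrix.single z (τ z) 1 + Matrix.single u (τ z) 1 + Matrix.single z (σ u) 1 := by
  apply exists_permCount_eq
  · intro i j
    simp only [permMatrix_eq_ite, Matrix.add_apply, Matrix.sub_apply, Matrix.single_apply]
    grind
  · intro i
    simp only [permMatrix_eq_ite, Matrix.add_apply, Matrix.sub_apply, Matrix.single_apply,
      sum_add_distrib, sum_sub_distrib]
    simp [ite_and]
    ring
  · intro j
    simp only [permMatrix_eq_ite, Matrix.add_apply, Matrix.sub_apply, Matrix.single_apply,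
      sum_add_distrib, sum_sub_distrib]
    simp [← Equiv.eq_symm_apply, ite_and]

/-- The exchange of `exists_permCount_exchange` inside a multiset of permutations; it touches at
most two of them. -/
theorem exists_exchange_in_multiset {q p : Perm α} {R : Multiset (Perm α)} (hp : p ∈ q ::ₘ R)
    (u z : α) :
    ∃ F G R' : Multiset (Perm α), R = F + R' ∧ F.card ≤ 1 ∧ G.card = F.card + 1 ∧
      permCount G = q.permMatrix ℤ + permCount F - Matrix.single u (q u) 1
        - Matrix.single z (p z) 1 + Matrix.single u (p z) 1 + Matrix.single z (q u) 1 := by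
  rcases Multiset.mem_cons.1 hp with rfl | hp
  · exact ⟨0, {p * swap u z}, R, by simp, by simp, by simp,
      by
        rw [permCount_zero, add_zero, ← permMatrix_mul_swap]
        simp [permCount]⟩
  · obtain ⟨R', rfl⟩ := Multiset.exists_cons_of_mem hp
    obtain ⟨G, hG, hGM⟩ := exists_permCount_exchange q p u z
    exact ⟨{p}, G, R', by simp, by simp, by simpa using hG, by simpa [permCount] using hGM⟩

theorem card_ne_mul_swap_lt {σ τ : Perm α} {x z : α} (hx : σ x ≠ τ x) (hz : σ x = τ z) :
    #{i | (σ * swap x z) i ≠ τ i} < #{i | σ i ≠ τ i} := by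
  have hzx : z ≠ x := by rintro rfl; exact hx hz
  refine card_lt_card ((ssubset_iff_of_subset ?_).2 ⟨z, ?_, ?_⟩)
  · intro i
    simp only [mem_filter_univ, Perm.mul_apply, swap_apply_def]
    grind
  · have := σ.injective.ne hzx
    simp only [mem_filter_univ]
    grind
  · rw [mem_filter_univ, Perm.mul_apply, swap_apply_right]
    simpa using hz

variable {C : Type*} [CommMonoid C] {w : Perm α → C}

/-- The product of `w` over a multiset of permutations is invariant under moves of degree at most three. -/
def CubicInvariant (w : Perm α → C) : Prop :=
  ∀ U V : Multiset (Perm α), U.card = V.card → U.card ≤ 3 → permCount U = permCount V →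
    (U.map w).prod = (V.map w).prod

/-- Let `D + R` be a multiset of permutations whose matrix sum `A` has `τ` in its support. Suppose
`D` arises from a pair `P, q` by exchanging the entry of `P` at `x` with the entry `(u, v)` of `q`.
Then moves of degree at most three lead to a multiset with a member that agrees with `τ` at least
as often as `P` does. -/
theorem CubicInvariant.exists_of_defect (hw : CubicInvariant w) {A : Matrix α α ℤ} {τ : Perm α}
    (hA : ∀ i, 0 < A i (τ i)) {x v : α} (hv : τ x ≠ v) :
    ∀ (P q : Perm α) (u : α) (D R : Multiset (Perm α)), D.card = 2 → permCount (D + R) = A →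
      permCount D = P.permMatrix ℤ + q.permMatrix ℤ - Matrix.single x (P x) 1
        - Matrix.single u (q u) 1 + Matrix.single x (q u) 1 + Matrix.single u (P x) 1 →
      q u = v → P u = τ u → u ≠ x → (∃ y, y ≠ x ∧ P y = v ∧ τ y = v) →
      ∃ (S : Multiset (Perm α)) (σ : Perm α), σ ∈ S ∧ S.card = (D + R).card ∧ permCount S = A ∧
        (S.map w).prod = ((D + R).map w).prod ∧ #{i | σ i ≠ τ i} ≤ #{i | P i ≠ τ i} := by
  intro P
  induction hd : #{i | P i ≠ τ i} using Nat.strong_induction_on generalizing P with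
  | _ d ih =>
  rintro q u D R hD hDR hDM hqu hPu hux ⟨y, hyx, hPy, hτy⟩
  obtain ⟨z, hz⟩ := τ.surjective (P x)
  have hPxv : P x ≠ v := fun h => hyx (P.injective (hPy.trans h.symm))
  have huz : u ≠ z := by
    rintro rfl
    exact hux (P.injective (hPu.trans hz))
  obtain ⟨p, hp, hpz⟩ : ∃ p ∈ q ::ₘ R, p z = P x := by
    rw [← permCount_pos_iff]
    have h := hA z
    rw [← hDR, permCount_add, hDM, hz, hqu] at h
    simp only [permCount_cons, permMatrix_eq_ite, Matrix.add_apply, Matrix.sub_apply,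
      Matrix.single_apply, P.injective.eq_iff] at h ⊢
    grind
  obtain ⟨F, G, R', rfl, hF, hG, hGM⟩ := exists_exchange_in_multiset hp u z
  rw [hpz] at hGM
  by_cases hzx : z = x
  · subst hzx
    refine ⟨P ::ₘ G + R', P, by simp, by simp [hD, hG]; ring, ?_, ?_, hd.le⟩
    · rw [← hDR]
      simp only [permCount_add, permCount_cons, hDM, hGM]
      abel
    · have := hw (P ::ₘ G) (D + F) (by simp [hD, hG]; ring) (by simp [hG]; lia)
        (by simp only [permCount_add, permCount_cons, hDM, hGM]; abel)
      rw [← add_assoc D, Multiset.map_add, Multiset.prod_add, this]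
      simp
  · obtain ⟨q', hq'G, hq'z⟩ : ∃ q' ∈ G, q' z = v := by
      rw [← permCount_pos_iff, hGM, hqu]
      have := permCount_nonneg F z v
      simp only [permMatrix_eq_ite, Matrix.add_apply, Matrix.sub_apply, Matrix.single_apply]
      grind
    obtain ⟨G', rfl⟩ := Multiset.exists_cons_of_mem hq'G
    obtain ⟨D', hD', hDM'⟩ := exists_permCount_exchange (P * swap x z) q' x z
    have hG' : G'.card = F.card := by simpa using hG
    have key : permCount (D' + G') = permCount (D + F) := by
      simp only [permCount_cons] at hGM
      rw [← eq_sub_iff_add_eq'] at hGM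
      simp only [permCount_add, hDM', hDM, hGM, permMatrix_mul_swap, hq'z, hqu, Perm.mul_apply,
        swap_apply_left]
      abel
    have hlt := card_ne_mul_swap_lt (τ := τ) (fun h => hzx (τ.injective (hz.trans h))) hz.symm
    have hyz : y ≠ z := by
      rintro rfl
      exact hPxv (hz.symm.trans hτy)
    obtain ⟨S, σ, hσ, hcard, hSA, hSw, hle⟩ := ih _ (hd ▸ hlt) _ rfl q' z D' (G' + R') hD'
      (by rw [← add_assoc, permCount_add, key, ← hDR, ← add_assoc, permCount_add _ R'])
      hDM' hq'z (by simp [hz]) hzx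
      ⟨y, hyx, by simp [swap_apply_of_ne_of_ne hyx hyz, hPy], hτy⟩
    refine ⟨S, σ, hσ, ?_, hSA, ?_, hle.trans (hd ▸ hlt.le)⟩
    · rw [hcard]
      simp [hD, hD', hG']
    · have := hw (D' + G') (D + F) (by simp [hD, hD', hG']) (by simp [hD', hG']; lia) key
      rw [hSw, ← add_assoc, ← add_assoc, Multiset.map_add, Multiset.prod_add, this]
      simp

/-- A permutation in the support of the matrix sum of a multiset `S` becomes a member of `S` after
moves of degree at most three. -/
theorem CubicInvariant.exists_mem (hw : CubicInvariant w) {τ : Perm α} :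
    ∀ (σ : Perm α) (S : Multiset (Perm α)), σ ∈ S → (∀ i, 0 < permCount S i (τ i)) →
    ∃ S' : Multiset (Perm α), τ ∈ S' ∧ S'.card = S.card ∧ permCount S' = permCount S ∧
      (S'.map w).prod = (S.map w).prod := by
  intro σ
  induction hd : #{i | σ i ≠ τ i} using Nat.strong_induction_on generalizing σ with
  | _ d ih =>
  intro S hσ hS
  by_cases hστ : σ = τ
  · exact ⟨S, hστ ▸ hσ, rfl, rfl, rfl⟩
  obtain ⟨x, hx⟩ : ∃ x, σ x ≠ τ x := by
    by_contra! h
    exact hστ (Equiv.ext h)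
  obtain ⟨z, hz⟩ := τ.surjective (σ x)
  have hzx : z ≠ x := by rintro rfl; exact hx hz.symm
  obtain ⟨S₁, rfl⟩ := Multiset.exists_cons_of_mem hσ
  obtain ⟨q, hq, hqz⟩ : ∃ q ∈ S₁, q z = σ x := by
    rw [← permCount_pos_iff]
    simpa [permMatrix_eq_ite, hz, hzx] using hS z
  obtain ⟨R, rfl⟩ := Multiset.exists_cons_of_mem hq
  have hlt := card_ne_mul_swap_lt hx hz.symm
  obtain ⟨S', σ', hσ', hcard, hM, hprod, hle⟩ := hw.exists_of_defect hS hx.symm (σ * swap x z) q z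
    {σ, q} R rfl (by simp [permCount]) (by
      rw [permMatrix_mul_swap, Perm.mul_apply, swap_apply_left, hqz]
      simp only [Multiset.insert_eq_cons, ← Multiset.cons_zero, permCount_cons, permCount_zero]
      abel) hqz (by simp [hz]) hzx ⟨z, hzx, by simp, hz⟩
  obtain ⟨S'', hτ, hcard', hM', hprod'⟩ := ih _ (hd ▸ hle.trans_lt hlt) σ' rfl S' hσ' (hM ▸ hS)
  exact ⟨S'', hτ, by simpa [hcard'] using hcard, hM'.trans hM, by simpa [hprod'] using hprod⟩

/-- Multisets of permutations with the same matrix sum are connected by moves involving at most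
three permutations at a time. -/
theorem CubicInvariant.prod_eq (hw : CubicInvariant w) {S T : Multiset (Perm α)}
    (hcard : S.card = T.card) (h : permCount S = permCount T) :
    (S.map w).prod = (T.map w).prod := by
  induction T using Multiset.induction_on generalizing S with
  | empty => simp_all
  | cons τ T ih =>
    obtain ⟨σ, hσ⟩ : ∃ σ, σ ∈ S := Multiset.card_pos_iff_exists_mem.1 (by simp [hcard])
    obtain ⟨S', hτ, hcard', hM, hprod⟩ := hw.exists_mem (τ := τ) σ S hσ fun i =>
      h ▸ permCount_pos_iff.2 ⟨τ, by simp, rfl⟩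
    obtain ⟨S'', rfl⟩ := Multiset.exists_cons_of_mem hτ
    rw [← hprod, Multiset.map_cons, Multiset.prod_cons,
      ih (by simpa [hcard] using hcard') (by simpa [h] using hM)]
    simp

end Birkhoff

section Extension
open Equiv Finset

variable {β γ : Type*}

/-- The involution of `β ⊕ γ` that exchanges `j` and `σ j` and fixes the elements of `γ` outside
the range of `σ`. -/
noncomputable def extendToPerm (σ : β ↪ γ) : Perm (β ⊕ γ) :=
  Function.Involutive.toPerm (Sum.elim (Sum.inr ∘ σ) (Function.extend σ Sum.inl Sum.inr)) <| by
    rintro (j | k)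
    · simp [σ.injective.extend_apply]
    · by_cases h : ∃ j, σ j = k
      · obtain ⟨j, rfl⟩ := h
        simp [σ.injective.extend_apply]
      · simp [Function.extend_apply' _ _ _ h]

@[simp]
theorem extendToPerm_inl (σ : β ↪ γ) (j : β) : extendToPerm σ (.inl j) = .inr (σ j) := rfl

theorem extendToPerm_apply (σ : β ↪ γ) (j : β) : extendToPerm σ (.inr (σ j)) = .inl j :=
  σ.injective.extend_apply _ _ _

theorem extendToPerm_of_notMem {σ : β ↪ γ} {k : γ} (h : ¬∃ j, σ j = k) :
    extendToPerm σ (.inr k) = .inr k :=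
  Function.extend_apply' _ _ _ h

theorem extendToPerm_inr_eq_inl (σ : β ↪ γ) (j : β) (k : γ) :
    extendToPerm σ (.inr k) = .inl j ↔ σ j = k := by
  constructor
  · intro h
    by_contra hk
    by_cases hj : ∃ j, σ j = k
    · obtain ⟨i, rfl⟩ := hj
      simp_all [extendToPerm_apply]
    · simp [extendToPerm_of_notMem hj] at h
  · rintro rfl
    exact extendToPerm_apply σ j

variable [Fintype β] [Fintype γ] [DecidableEq β] [DecidableEq γ]

theorem permCount_map_extendToPerm_congr {U V : Multiset (β ↪ γ)} (hcard : U.card = V.card)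
    (h : ∀ j k, U.countP (fun σ => σ j = k) = V.countP fun σ => σ j = k) :
    permCount (U.map extendToPerm) = permCount (V.map extendToPerm) := by
  have hinl (i : β) (W : Multiset (β ↪ γ)) (j : β) :
      permCount (W.map extendToPerm) (.inl i) (.inl j) = 0 := by
    simp [permCount_apply, Multiset.countP_map]
  have hoff (i : γ) (j : β ⊕ γ) (hj : j ≠ .inr i) :
      permCount (U.map extendToPerm) (.inr i) j = permCount (V.map extendToPerm) (.inr i) j := by
    obtain j | k := j
    · simpa [permCount_apply, Multiset.countP_map, extendToPerm_inr_eq_inl,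
        ← Multiset.countP_eq_card_filter] using h j i
    · have hz (W : Multiset (β ↪ γ)) :
          permCount (W.map extendToPerm) (.inr i) (.inr k) = 0 := by
        rw [permCount_apply, Nat.cast_eq_zero, Multiset.countP_eq_zero]
        simp only [Multiset.mem_map, forall_exists_index, and_imp, forall_apply_eq_imp_iff₂]
        intro σ _ hσ
        by_cases hi : ∃ j, σ j = i
        · obtain ⟨j, rfl⟩ := hi
          simp [extendToPerm_apply] at hσ
        · rw [extendToPerm_of_notMem hi] at hσ
          exact hj hσ.symm
      rw [hz, hz]
  ext (i | i) j
  · obtain j | k := j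
    · rw [hinl, hinl]
    · simpa [permCount_apply, Multiset.countP_map,
        ← Multiset.countP_eq_card_filter] using h i k
  · by_cases hj : j = .inr i
    · subst hj
      have hU := sum_permCount_row (U.map extendToPerm) (.inr i)
      have hV := sum_permCount_row (V.map extendToPerm) (.inr i)
      rw [← add_sum_erase _ _ (mem_univ (Sum.inr i))] at hU hV
      rw [sum_congr rfl fun j hj => hoff i j (ne_of_mem_erase hj)] at hU
      simp only [Multiset.card_map, hcard] at hU hV
      lia
    · exact hoff i j hj

/-- The embedding `j ↦ k` where `π (inl j) = inr k`, if `π` sends `β` into `γ`, and a default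
value otherwise. -/
noncomputable def restrictToEmbedding (σ₀ : β ↪ γ) (π : Perm (β ⊕ γ)) : β ↪ γ :=
  open Classical in
  if h : ∀ j, ∃ k, π (.inl j) = .inr k then
    ⟨fun j => (h j).choose, fun i j hij => by
      have := (h i).choose_spec.trans ((congrArg Sum.inr hij).trans (h j).choose_spec.symm)
      simpa using this⟩
  else σ₀

theorem inr_restrictToEmbedding {σ₀ : β ↪ γ} {π : Perm (β ⊕ γ)}
    (h : ∀ j, ∃ k, π (.inl j) = .inr k) (j : β) :
    .inr (restrictToEmbedding σ₀ π j) = π (.inl j) := by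
  rw [restrictToEmbedding, dif_pos h]
  exact (h j).choose_spec.symm

@[simp]
theorem restrictToEmbedding_extendToPerm (σ₀ σ : β ↪ γ) :
    restrictToEmbedding σ₀ (extendToPerm σ) = σ := by
  ext j
  simpa using inr_restrictToEmbedding (σ₀ := σ₀) (π := extendToPerm σ) (by simp) j

/-- A multiset product over embeddings is determined by the entry counts as soon as this holds
for multisets of at most three embeddings. -/
theorem prod_map_embedding_eq {C : Type*} [CommMonoidWithZero C] {w : (β ↪ γ) → C}
    (hw : ∀ U V : Multiset (β ↪ γ), U.card = V.card → U.card ≤ 3 →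
      (∀ j k, U.countP (fun σ => σ j = k) = V.countP fun σ => σ j = k) →
      (U.map w).prod = (V.map w).prod)
    {U V : Multiset (β ↪ γ)} (hcard : U.card = V.card)
    (h : ∀ j k, U.countP (fun σ => σ j = k) = V.countP fun σ => σ j = k) :
    (U.map w).prod = (V.map w).prod := by
  classical
  obtain rfl | hU := eq_or_ne U 0
  · rw [Multiset.card_zero, eq_comm, Multiset.card_eq_zero] at hcard
    rw [hcard]
  obtain ⟨σ₀, -⟩ := Multiset.exists_mem_of_ne_zero hU
  let w' (π : Perm (β ⊕ γ)) : C :=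
    if ∀ j, ∃ k, π (.inl j) = .inr k then w (restrictToEmbedding σ₀ π) else 0
  have hzero {S : Multiset (Perm (β ⊕ γ))} {j j' : β} (hS : 0 < permCount S (.inl j) (.inl j')) :
      (S.map w').prod = 0 := by
    obtain ⟨π, hπ, hj⟩ := permCount_pos_iff.1 hS
    exact Multiset.prod_eq_zero (Multiset.mem_map.2 ⟨π, hπ, if_neg fun hg => by
      simpa [hj] using hg j⟩)
  have hgood {S : Multiset (Perm (β ⊕ γ))} (hS : ∀ j j', ¬0 < permCount S (.inl j) (.inl j')) :
      ∀ π ∈ S, ∀ j, ∃ k, π (.inl j) = .inr k := by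
    intro π hπ j
    rcases hj : π (.inl j) with j' | k
    · exact absurd (permCount_pos_iff.2 ⟨π, hπ, hj⟩) (hS j j')
    · exact ⟨k, rfl⟩
  have hprod {S : Multiset (Perm (β ⊕ γ))} (hS : ∀ π ∈ S, ∀ j, ∃ k, π (.inl j) = .inr k) :
      (S.map w').prod = ((S.map (restrictToEmbedding σ₀)).map w).prod := by
    rw [Multiset.map_map]
    exact congrArg _ (Multiset.map_congr rfl fun π hπ => if_pos (hS π hπ))
  have hcount {S : Multiset (Perm (β ⊕ γ))} (hS : ∀ π ∈ S, ∀ j, ∃ k, π (.inl j) = .inr k)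
      (j : β) (k : γ) : ((S.map (restrictToEmbedding σ₀)).countP (fun σ => σ j = k) : ℤ) =
        permCount S (.inl j) (.inr k) := by
    rw [permCount_apply, Multiset.countP_map, ← Multiset.countP_eq_card_filter]
    congr 1
    refine Multiset.countP_congr rfl fun π hπ => ?_
    rw [← inr_restrictToEmbedding (σ₀ := σ₀) (hS π hπ) j, Sum.inr.injEq]
  have hw' : CubicInvariant w' := by
    intro S T hST hS3 hM
    by_cases hS : ∃ j j', 0 < permCount S (.inl j) (.inl j')
    · obtain ⟨j, j', hS⟩ := hS
      rw [hzero hS, hzero (hM ▸ hS)]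
    · push Not at hS
      have gS := hgood fun j j' => (hS j j').not_gt
      have gT := hgood fun j j' => (hM ▸ hS j j').not_gt
      rw [hprod gS, hprod gT]
      refine hw _ _ (by simpa using hST) (by simpa using hS3) fun j k => ?_
      have := hcount gS j k
      rw [hM, ← hcount gT j k] at this
      exact_mod_cast this
  have hext (W : Multiset (β ↪ γ)) : ((W.map extendToPerm).map w').prod = (W.map w).prod := by
    rw [hprod (by simp)]
    simp
  rw [← hext U, ← hext V]
  exact hw'.prod_eq (by simpa using hcard) (permCount_map_extendToPerm_congr hcard h)

end Extension

section Toric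
open MvPolynomial

variable {n r : ℕ} {K : Type} [Field K]

/-- The sufficient statistics of a multiset of injections: the exponent vector of the image of the
corresponding monomial under `birkhoffHom`. -/
noncomputable def entryCount (U : Multiset (Fin r ↪ Fin n)) : Fin r × Fin n →₀ ℕ :=
  (U.map fun σ => ∑ j, Finsupp.single (j, σ j) 1).sum

theorem entryCount_cons (σ : Fin r ↪ Fin n) (U : Multiset (Fin r ↪ Fin n)) :
    entryCount (σ ::ₘ U) = ∑ j, Finsupp.single (j, σ j) 1 + entryCount U := by
  simp [entryCount]

theorem entryCount_apply (U : Multiset (Fin r ↪ Fin n)) (j : Fin r) (k : Fin n) :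
    entryCount U (j, k) = U.countP fun σ => σ j = k := by
  induction U using Multiset.induction_on with
  | empty => simp [entryCount]
  | cons σ U ih =>
    rw [entryCount_cons, Finsupp.add_apply, ih, Multiset.countP_cons, add_comm]
    simp [Finsupp.finsetSum_apply, Finsupp.single_apply, ite_and]

theorem degree_entryCount (U : Multiset (Fin r ↪ Fin n)) :
    (entryCount U).degree = r * U.card := by
  induction U using Multiset.induction_on with
  | empty => simp [entryCount]
  | cons σ U ih =>
    rw [entryCount_cons, map_add, ih, map_sum]
    simp [Finsupp.degree_single, mul_add, add_comm]

theorem prod_map_X_eq_monomial {ι : Type*} [DecidableEq ι] (U : Multiset ι) :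
    (U.map fun i => (X i : MvPolynomial ι K)).prod = monomial (Multiset.toFinsupp U) 1 := by
  induction U using Multiset.induction_on with
  | empty => simp
  | cons i U ih =>
    rw [Multiset.map_cons, Multiset.prod_cons, ih, X, monomial_mul, ← Multiset.singleton_add,
      map_add, Multiset.toFinsupp_singleton, one_mul]

theorem birkhoffHom_prod_map_X (U : Multiset (Fin r ↪ Fin n)) :
    birkhoffHom n r K (U.map X).prod = monomial (entryCount U) 1 := by
  induction U using Multiset.induction_on with
  | empty => simp [entryCount]
  | cons σ U ih =>
    rw [Multiset.map_cons, Multiset.prod_cons, map_mul, ih, entryCount_cons, ← one_mul (1 : K),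
      ← monomial_mul, monomial_sum_one, one_mul]
    rw [birkhoffHom, aeval_X]
    rfl

end Toric

/-- For `2 ≤ r ≤ n` and `n ≥ 3`, the toric ideal `I_{A_{n,r}}` of the
`(n,r)`-Birkhoff model is generated by the binomials it contains of degree at most
three, i.e. by its elements of the form `m₁ - m₂` with `m₁, m₂` monomials of equal
degree at most three. -/
theorem toricIdeal_generated_by_binomials_of_degree_le_three
    (n r : ℕ) (hr : 2 ≤ r) (hrn : r ≤ n) (hn : 3 ≤ n) (K : Type) [Field K] :
    toricIdeal n r K =
      Ideal.span {f : MvPolynomial (Fin r ↪ Fin n) K |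
        f ∈ toricIdeal n r K ∧
        ∃ u v : (Fin r ↪ Fin n) →₀ ℕ,
          (u.sum fun _ m => m) = (v.sum fun _ m => m) ∧
          (u.sum fun _ m => m) ≤ 3 ∧
          f = MvPolynomial.monomial u (1 : K) - MvPolynomial.monomial v (1 : K)} := by
  refine le_antisymm ?_ (Ideal.span_le.2 fun f hf => hf.1)
  set J := Ideal.span {f : MvPolynomial (Fin r ↪ Fin n) K |
        f ∈ toricIdeal n r K ∧
        ∃ u v : (Fin r ↪ Fin n) →₀ ℕ,
          (u.sum fun _ m => m) = (v.sum fun _ m => m) ∧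
          (u.sum fun _ m => m) ≤ 3 ∧
          f = MvPolynomial.monomial u (1 : K) - MvPolynomial.monomial v (1 : K)}
  have hmk (U V : Multiset (Fin r ↪ Fin n)) (hUV : entryCount U = entryCount V) :
      (U.map fun σ => Ideal.Quotient.mk J (MvPolynomial.X σ)).prod =
        (V.map fun σ => Ideal.Quotient.mk J (MvPolynomial.X σ)).prod := by
    have hcard : U.card = V.card := by
      have := congrArg Finsupp.degree hUV
      rw [degree_entryCount, degree_entryCount] at this
      exact Nat.eq_of_mul_eq_mul_left (by lia) this
    refine prod_map_embedding_eq (fun U V hcard h3 h => ?_) hcard fun j k => by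
      rw [← entryCount_apply, hUV, entryCount_apply]
    have hE : entryCount U = entryCount V := by
      ext ⟨j, k⟩
      rw [entryCount_apply, entryCount_apply, h]
    have hsum (W : Multiset (Fin r ↪ Fin n)) :
        ((Multiset.toFinsupp W).sum fun _ m => m) = W.card := by
      exact (Finsupp.card_toMultiset _).symm.trans (by rw [Multiset.toFinsupp_toMultiset])
    simp_rw [← Function.comp_apply (f := Ideal.Quotient.mk J), ← Multiset.map_map,
      ← map_multiset_prod]
    refine Ideal.Quotient.eq.2 (Ideal.subset_span ⟨?_, Multiset.toFinsupp U, Multiset.toFinsupp V,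
      by rw [hsum, hsum, hcard], by rwa [hsum], ?_⟩)
    · rw [toricIdeal, RingHom.mem_ker, map_sub, birkhoffHom_prod_map_X, birkhoffHom_prod_map_X,
        hE, sub_self]
    · rw [← prod_map_X_eq_monomial, ← prod_map_X_eq_monomial]
  let L : MvPolynomial (Fin r × Fin n) K →ₗ[K] MvPolynomial (Fin r ↪ Fin n) K ⧸ J :=
    (MvPolynomial.basisMonomials _ K).constr K fun e =>
      ((Function.invFun entryCount e).map fun σ => Ideal.Quotient.mk J (MvPolynomial.X σ)).prod
  have hL : L ∘ₗ (birkhoffHom n r K).toLinearMap = (Ideal.Quotient.mkₐ K J).toLinearMap := by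
    refine (MvPolynomial.basisMonomials _ K).ext fun u => ?_
    have hu : MvPolynomial.basisMonomials _ K u =
        ((Finsupp.toMultiset u).map (MvPolynomial.X (R := K))).prod := by
      rw [prod_map_X_eq_monomial, Finsupp.toMultiset_toFinsupp, MvPolynomial.coe_basisMonomials]
    have hinv : entryCount (Function.invFun entryCount (entryCount (Finsupp.toMultiset u))) =
        entryCount (Finsupp.toMultiset u) := Function.invFun_eq ⟨_, rfl⟩
    rw [hu, LinearMap.comp_apply, AlgHom.toLinearMap_apply, birkhoffHom_prod_map_X,
      ← congrFun (MvPolynomial.coe_basisMonomials _ K), Module.Basis.constr_basis,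
      hmk _ _ hinv, AlgHom.toLinearMap_apply, Ideal.Quotient.mkₐ_eq_mk, map_multiset_prod,
      Multiset.map_map]
    rfl
  intro f hf
  have := LinearMap.congr_fun hL f
  rw [LinearMap.comp_apply, AlgHom.toLinearMap_apply, RingHom.mem_ker.1 hf, map_zero] at this
  exact Ideal.Quotient.eq_zero_iff_mem.1 this.symm
end

section
/- Let n and r be integers with 2 ≤ r ≤ n and n ≥ 3. For every t and every x, y ∈ ℕ^{S_{n,r}} with A_{n,r} x = A_{n,r} y = t, there exists a sequence x = x₀, x₁, …, x_m = y such that every x_i lies in ℕ^{S_{n,r}} with A_{n,r} x_i = t and every difference x_{i+1} − x_i is a move of degree at most three. In other words, the set of all moves of degree at most three is a Markov basis for A_{n,r}. -/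
/-- The sufficient-statistic map (configuration matrix `A_{n,r}` applied to a
nonnegative integer vector indexed by `S_{n,r}`, the injections from `Fin r` to `Fin n`):
the `(j,k)` coordinate counts, with multiplicity `x σ`, the votes `σ` with `σ j = k`. -/
noncomputable def suffN (n r : ℕ) (x : (Fin r ↪ Fin n) → ℕ) : Fin r × Fin n → ℕ :=
  fun p => ∑ σ : Fin r ↪ Fin n, if σ p.1 = p.2 then x σ else 0

/-- The configuration matrix `A_{n,r}` applied to an integer vector. -/
noncomputable def suffZ (n r : ℕ) (z : (Fin r ↪ Fin n) → ℤ) : Fin r × Fin n → ℤ :=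
  fun p => ∑ σ : Fin r ↪ Fin n, if σ p.1 = p.2 then z σ else 0

/-- The degree of a move `z`: `Σ_σ max(z σ, 0)`. -/
noncomputable def moveDeg (n r : ℕ) (z : (Fin r ↪ Fin n) → ℤ) : ℕ :=
  ∑ σ : Fin r ↪ Fin n, (z σ).toNat

namespace BirkhoffModel

open Finset

/-- The reflexive transitive closure of a relation is realised by finite paths. -/
lemma exists_path_of_reflTransGen {β : Type*} {R : β → β → Prop} {a b : β}
    (h : Relation.ReflTransGen R a b) :
    ∃ (m : ℕ) (w : ℕ → β), w 0 = a ∧ w m = b ∧ ∀ i < m, R (w i) (w (i + 1)) := by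
  induction h using Relation.ReflTransGen.head_induction_on with
  | refl => exact ⟨0, fun _ => b, rfl, rfl, by simp⟩
  | @head a c hac _ ih =>
    obtain ⟨m, w, h0, hm, hw⟩ := ih
    refine ⟨m + 1, fun i => Nat.casesOn i a w, rfl, hm, ?_⟩
    rintro (_ | i) hi
    · simpa [h0] using hac
    · exact hw i (by omega)

section Rows

variable {α Q : Type*} [Fintype α] (π : α → Q)

/-- The edges of a row `f`: pairs of a position, seen through `π`, and the candidate there. -/
def edges (f : α → α) : Multiset (Q × α) := ∑ j, {(π j, f j)}

/-- The edges of a multiset of rows, all of which are permutations. -/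
def edgesSum (s : Multiset (Equiv.Perm α)) : Multiset (Q × α) :=
  (s.map fun a => edges π a).sum

/-- Replacing at most three rows without changing the edges. -/
def Step (s t : Multiset (Equiv.Perm α)) : Prop :=
  ∃ A B u, s = A + u ∧ t = B + u ∧ Multiset.card B ≤ 3 ∧ edgesSum π A = edgesSum π B

@[simp] lemma edgesSum_zero : edgesSum π (0 : Multiset (Equiv.Perm α)) = 0 := rfl

@[simp] lemma edgesSum_cons (a : Equiv.Perm α) (s : Multiset (Equiv.Perm α)) :
    edgesSum π (a ::ₘ s) = edges π a + edgesSum π s := by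
  simp [edgesSum]

@[simp] lemma edgesSum_add (s t : Multiset (Equiv.Perm α)) :
    edgesSum π (s + t) = edgesSum π s + edgesSum π t := by
  simp [edgesSum]

variable {π}

lemma mem_edges {f : α → α} {p : Q × α} : p ∈ edges π f ↔ ∃ j, (π j, f j) = p := by
  simp [edges, Multiset.mem_sum, eq_comm]

lemma mem_edgesSum {s : Multiset (Equiv.Perm α)} {p : Q × α} :
    p ∈ edgesSum π s ↔ ∃ a ∈ s, p ∈ edges π a := by
  induction s using Multiset.induction with
  | empty => simp
  | cons a s ih => simp [ih]

lemma Step.cons {s t : Multiset (Equiv.Perm α)} (a : Equiv.Perm α) (h : Step π s t) :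
    Step π (a ::ₘ s) (a ::ₘ t) := by
  obtain ⟨A, B, u, rfl, rfl, hB, hE⟩ := h
  exact ⟨A, B, a ::ₘ u, by simp, by simp, hB, hE⟩

lemma Step.edgesSum_eq {s t : Multiset (Equiv.Perm α)} (h : Step π s t) :
    edgesSum π s = edgesSum π t := by
  obtain ⟨A, B, u, rfl, rfl, -, hE⟩ := h
  simp [hE]

lemma edgesSum_eq_of_reflTransGen {s t : Multiset (Equiv.Perm α)}
    (h : Relation.ReflTransGen (Step π) s t) : edgesSum π s = edgesSum π t := by
  induction h with
  | refl => rfl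
  | tail _ h ih => exact ih.trans h.edgesSum_eq

lemma card_edgesSum (s : Multiset (Equiv.Perm α)) :
    Multiset.card (edgesSum π s) = Multiset.card s * Fintype.card α := by
  induction s using Multiset.induction with
  | empty => simp
  | cons a s ih => simp [ih, edges, Multiset.card_sum, add_mul, add_comm]

variable [DecidableEq α]

lemma edges_update (f : α → α) (j v : α) :
    edges π (Function.update f j v) + {(π j, f j)} = edges π f + {(π j, v)} := by
  unfold edges
  rw [← Finset.add_sum_erase _ _ (mem_univ j), ← Finset.add_sum_erase _ (fun i => {(π i, f i)})
    (mem_univ j), Finset.sum_congr (g := fun i => {(π i, f i)}) rfl]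
  · simp only [Function.update_self]
    abel
  · intro i hi
    rw [Function.update_of_ne (Finset.ne_of_mem_erase hi)]

lemma edges_update_add_update (f g : α → α) {i j : α} (h : π i = π j) :
    edges π (Function.update f i (g j)) + edges π (Function.update g j (f i)) =
      edges π f + edges π g := by
  have h1 := edges_update (π := π) f i (g j)
  have h2 := edges_update (π := π) g j (f i)
  rw [h] at h1
  apply add_right_cancel (b := {(π j, f i)} + {(π j, g j)})
  calc _ = (edges π (Function.update f i (g j)) + {(π j, f i)}) +
        (edges π (Function.update g j (f i)) + {(π j, g j)}) := by abel
    _ = _ := by rw [h1, h2]; abel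

lemma edges_comp_swap (f : α → α) {i j : α} (h : π i = π j) :
    edges π (f ∘ Equiv.swap i j) = edges π f := by
  unfold edges
  refine Fintype.sum_equiv (Equiv.swap i j) _ _ fun k => ?_
  have : π (Equiv.swap i j k) = π k := by
    rw [Equiv.swap_apply_def]; split_ifs <;> simp_all
  simp [this]

/-- Number of positions whose candidate lies in `N`. -/
lemma countP_edges (f : α → α) (N : Finset α) :
    (edges π f).countP (fun p => p.2 ∈ N) = #{j | f j ∈ N} := by
  have : edges π f = Finset.univ.val.map fun j => (π j, f j) := by
    rw [← Multiset.sum_map_singleton (Multiset.map _ _), Multiset.map_map]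
    rfl
  rw [this, Multiset.countP_map]
  rfl

lemma card_filter_perm (a : Equiv.Perm α) (N : Finset α) : #{j | a j ∈ N} = #N := by
  rw [← Finset.card_map (Equiv.toEmbedding a)]
  congr 1
  ext k
  simp only [mem_map, mem_filter, mem_univ, true_and, Equiv.coe_toEmbedding]
  exact ⟨by rintro ⟨j, hj, rfl⟩; exact hj, fun hk => ⟨a.symm k, by simpa, by simp⟩⟩

lemma exists_perm_eq {f : α → α} (h : ∀ N : Finset α, #{j | f j ∈ N} = #N) :
    ∃ a : Equiv.Perm α, ⇑a = f := by
  have hs : Function.Surjective f := fun k => by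
    have hk := h {k}
    obtain ⟨j, hj⟩ := Finset.card_pos.mp (by rw [hk]; simp : 0 < #{j | f j ∈ ({k} : Finset α)})
    exact ⟨j, by simpa using hj⟩
  exact ⟨Equiv.ofBijective f (Finite.surjective_iff_bijective.mp hs), rfl⟩

/-- Two rows whose joint degrees exceed two by at most one in total can be rearranged so that
one of them becomes a permutation. -/
lemma exists_perm_rearrange (f g : α → α)
    (h : ∀ N : Finset α, #{j | f j ∈ N} + #{j | g j ∈ N} ≤ 2 * #N + 1) :
    ∃ (e : Equiv.Perm α) (c : α → α), edges π e + edges π c = edges π f + edges π g := by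
  obtain ⟨e, he, het⟩ := (Finset.all_card_le_biUnion_card_iff_exists_injective
    fun j => ({f j, g j} : Finset α)).mp fun S => by
      set N := S.biUnion fun j => ({f j, g j} : Finset α) with hN
      have hf : #S ≤ #{j | f j ∈ N} := Finset.card_le_card fun j hj => by
        simp only [mem_filter, mem_univ, true_and, hN, mem_biUnion]
        exact ⟨j, hj, by simp⟩
      have hg : #S ≤ #{j | g j ∈ N} := Finset.card_le_card fun j hj => by
        simp only [mem_filter, mem_univ, true_and, hN, mem_biUnion]
        exact ⟨j, hj, by simp⟩
      have := h N
      omega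
  refine ⟨Equiv.ofBijective e (Finite.injective_iff_bijective.mp he),
    fun j => if e j = f j then g j else f j, ?_⟩
  simp only [edges, ← Finset.sum_add_distrib, Equiv.ofBijective_apply]
  refine Finset.sum_congr rfl fun j _ => ?_
  split_ifs with hj
  · rw [hj]
  · have : e j = g j := by simpa [hj] using het j
    rw [this, add_comm]

/-- Two rows that jointly contain every candidate twice can be rearranged into permutations. -/
lemma exists_perm_perm_rearrange (f g : α → α)
    (h : ∀ N : Finset α, #{j | f j ∈ N} + #{j | g j ∈ N} = 2 * #N) :
    ∃ a b : Equiv.Perm α, edges π a + edges π b = edges π f + edges π g := by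
  obtain ⟨a, c, hac⟩ := exists_perm_rearrange (π := π) f g fun N => by rw [h]; omega
  obtain ⟨b, rfl⟩ := exists_perm_eq (f := c) fun N => by
    have := congrArg (Multiset.countP fun p => p.2 ∈ N) hac
    simp only [Multiset.countP_add, countP_edges, card_filter_perm, h] at this
    omega
  exact ⟨a, b, hac⟩

lemma card_le_of_injOn_compl_singleton {X : α → α} {j : α} (h : Set.InjOn X {j}ᶜ)
    (N : Finset α) : #N ≤ #{i | X i ∈ N} + 1 := by
  have h1 : #((univ.erase j).image X) = Fintype.card α - 1 := by
    rw [Finset.card_image_of_injOn (by simpa [Set.compl_eq_univ_sdiff] using h)]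
    simp
  have h2 : #(N ∩ (univ.erase j).image X) ≤ #{i | X i ∈ N} := by
    refine (Finset.card_le_card (t := ({i | X i ∈ N} : Finset α).image X) fun k hk => ?_).trans
      Finset.card_image_le
    simp only [mem_inter, mem_image, mem_erase, mem_univ, mem_filter, true_and] at hk ⊢
    obtain ⟨hk, i, -, rfl⟩ := hk
    exact ⟨i, hk, rfl⟩
  have h3 := Finset.card_union_add_card_inter N ((univ.erase j).image X)
  have h4 := Finset.card_le_univ (N ∪ (univ.erase j).image X)
  omega

/-- `X` together with a further row has the edges of two rows of a multiset reachable
from `s`. -/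
def Reaches (π : α → Q) (s : Multiset (Equiv.Perm α)) (X : α → α) : Prop :=
  ∃ (c : α → α) (a b : Equiv.Perm α) (u : Multiset (Equiv.Perm α)),
    edges π X + edges π c = edges π a + edges π b ∧
      Relation.ReflTransGen (Step π) s (a ::ₘ b ::ₘ u)

lemma exists_ne_injOn {X : α → α} {σ : Equiv.Perm α} {j : α} (h : Set.InjOn X {j}ᶜ)
    (hX : X ≠ σ) : ∃ i, X i ≠ σ i ∧ Set.InjOn X {i}ᶜ := by
  by_cases hj : X j = σ j
  · by_cases hi : Function.Injective X
    · obtain ⟨i, hi'⟩ := Function.ne_iff.mp hX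
      exact ⟨i, hi', hi.injOn⟩
    · simp only [Function.Injective, not_forall] at hi
      obtain ⟨i, k, hik, hne⟩ := hi
      have key : ∀ i, i ≠ j → X i = X j → ∃ i, X i ≠ σ i ∧ Set.InjOn X {i}ᶜ := by
        intro i hij hX
        refine ⟨i, fun h' => hij (σ.injective (by rw [← h', hX, hj])), ?_⟩
        intro a ha b hb hab
        simp only [Set.mem_compl_iff, Set.mem_singleton_iff] at ha hb
        by_cases haj : a = j
        · subst haj
          by_contra hne
          exact hb (h (by simpa using Ne.symm hne) (by simpa using hij) (by rw [← hab, hX]))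
        · by_cases hbj : b = j
          · subst hbj
            exact absurd (h (by simpa using haj) (by simpa using hij) (by rw [hab, hX])) ha
          · exact h (by simpa using haj) (by simpa using hbj) hab
      by_cases hi : i = j
      · subst hi
        exact key k (Ne.symm hne) hik.symm
      · by_cases hk : k = j
        · subst hk
          exact key i hi hik
        · exact absurd (h (by simpa using hi) (by simpa using hk) hik) hne
  · exact ⟨j, hj, h⟩

omit [Fintype α] in
lemma injOn_update {X : α → α} {j : α} (v : α) (h : Set.InjOn X {j}ᶜ) :
    Set.InjOn (Function.update X j v) {j}ᶜ :=
  h.congr fun i hi => (Function.update_of_ne (by simpa using hi) _ _).symm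

lemma card_agree_update {X : α → α} {σ : Equiv.Perm α} {j : α} (h : X j ≠ σ j) :
    #{i | X i = σ i} < #{i | Function.update X j (σ j) i = σ i} := by
  refine Finset.card_lt_card (Finset.ssubset_iff_of_subset ?_ |>.mpr ⟨j, by simp, by simpa⟩)
  intro i hi
  simp only [mem_filter, mem_univ, true_and] at hi ⊢
  rwa [Function.update_of_ne]
  rintro rfl
  exact h hi

/-- One more position of `X` can be made to agree with a row `σ` occurring in the fiber. -/
lemma Reaches.exists_agree_lt {s : Multiset (Equiv.Perm α)} {X : α → α} {σ : Equiv.Perm α}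
    {j : α} (hσ : edges π σ ≤ edgesSum π s) (hX : Reaches π s X) (hj : X j ≠ σ j)
    (hinj : Set.InjOn X {j}ᶜ) :
    ∃ Y i, Reaches π s Y ∧ Set.InjOn Y {i}ᶜ ∧ #{i | X i = σ i} < #{i | Y i = σ i} := by
  obtain ⟨c, a, b, u, hE, hs⟩ := hX
  have hmem : (π j, σ j) ∈ edges π X + edges π c + edgesSum π u := by
    have := edgesSum_eq_of_reflTransGen hs
    rw [edgesSum_cons, edgesSum_cons, ← add_assoc, ← hE] at this
    rw [← this]
    exact Multiset.mem_of_le hσ (mem_edges.mpr ⟨j, rfl⟩)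
  rw [Multiset.mem_add, Multiset.mem_add, mem_edges, mem_edges, mem_edgesSum] at hmem
  rcases hmem with (⟨i, hi⟩ | ⟨i, hi⟩) | ⟨d, hd, hi⟩
  · obtain ⟨hπ, hv⟩ := Prod.mk.inj hi
    have hij : i ≠ j := by rintro rfl; exact hj hv
    refine ⟨X ∘ Equiv.swap i j, i, ⟨c, a, b, u, by rwa [edges_comp_swap _ hπ], hs⟩, ?_, ?_⟩
    · refine hinj.comp (Equiv.injective _).injOn fun k hk => ?_
      simp only [Set.mem_compl_iff, Set.mem_singleton_iff] at hk ⊢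
      rwa [Equiv.swap_apply_eq_iff, Equiv.swap_apply_right]
    · refine Finset.card_lt_card
        (Finset.ssubset_iff_of_subset ?_ |>.mpr ⟨j, by simp [hv], by simpa⟩)
      intro k hk
      simp only [mem_filter, mem_univ, true_and, Function.comp_apply] at hk ⊢
      rwa [Equiv.swap_apply_of_ne_of_ne]
      · rintro rfl
        exact hij (σ.injective (by rw [← hk, hv]))
      · rintro rfl
        exact hj hk
  · obtain ⟨hπ, hv⟩ := Prod.mk.inj hi
    refine ⟨Function.update X j (σ j), j, ⟨Function.update c i (X j), a, b, u, ?_, hs⟩,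
      injOn_update _ hinj, card_agree_update hj⟩
    rw [← hE, ← hv, edges_update_add_update _ _ hπ.symm]
  · obtain ⟨i, hi⟩ := mem_edges.mp hi
    obtain ⟨hπ, hv⟩ := Prod.mk.inj hi
    obtain ⟨u, rfl⟩ := Multiset.exists_cons_of_mem hd
    set Y := Function.update X j (σ j) with hY
    set d' := Function.update d i (X j) with hd'
    have hYd : edges π Y + edges π d' = edges π X + edges π d := by
      rw [hY, hd', ← hv, edges_update_add_update _ _ hπ.symm]
    have hYinj : Set.InjOn Y {j}ᶜ := injOn_update _ hinj
    have htot : edges π Y + (edges π c + edges π d') = edges π a + edges π b + edges π d := by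
      calc _ = edges π c + (edges π Y + edges π d') := by abel
        _ = (edges π X + edges π c) + edges π d := by rw [hYd]; abel
        _ = _ := by rw [hE]
    have hcount (N : Finset α) :
        #{k | Y k ∈ N} + (#{k | c k ∈ N} + #{k | d' k ∈ N}) = 3 * #N := by
      have := congrArg (Multiset.countP fun p => p.2 ∈ N) htot
      simp only [Multiset.countP_add, countP_edges, card_filter_perm] at this
      omega
    obtain ⟨e, c', hec⟩ := exists_perm_rearrange (π := π) c d' fun N => by
      have := hcount N
      have := card_le_of_injOn_compl_singleton hYinj N
      omega
    obtain ⟨a', b', hab⟩ := exists_perm_perm_rearrange (π := π) Y c' fun N => by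
      have h1 := hcount N
      have h2 := congrArg (Multiset.countP fun p => p.2 ∈ N) hec
      simp only [Multiset.countP_add, countP_edges, card_filter_perm] at h2
      omega
    refine ⟨Y, j, ⟨c', a', b', e ::ₘ u, hab.symm, hs.tail ?_⟩, hYinj, card_agree_update hj⟩
    refine ⟨a ::ₘ b ::ₘ d ::ₘ 0, a' ::ₘ b' ::ₘ e ::ₘ 0, u, by simp, by simp, by simp, ?_⟩
    simp only [edgesSum_cons, edgesSum_zero, add_zero]
    calc _ = edges π a + edges π b + edges π d := by abel
      _ = edges π Y + (edges π e + edges π c') := by rw [← htot, hec]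
      _ = (edges π a' + edges π b') + edges π e := by rw [hab]; abel
      _ = _ := by abel

lemma Reaches.of_injOn {s : Multiset (Equiv.Perm α)} {σ : Equiv.Perm α}
    (hσ : edges π σ ≤ edgesSum π s) {X : α → α} {j : α} (hX : Reaches π s X)
    (hinj : Set.InjOn X {j}ᶜ) : Reaches π s σ := by
  induction hk : Fintype.card α - #{i | X i = σ i} using Nat.strong_induction_on
    generalizing X j with
  | _ k ih =>
    by_cases hXσ : X = σ
    · rwa [← hXσ]
    · obtain ⟨i, hi, hinj⟩ := exists_ne_injOn hinj hXσ
      obtain ⟨Y, i', hY, hYinj, hlt⟩ := hX.exists_agree_lt hσ hi hinj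
      have := Finset.card_le_univ ({i | Y i = σ i} : Finset α)
      exact ih _ (by omega) hY hYinj rfl

/-- A row `σ` whose edges occur in `s` can be made a row of the multiset. -/
lemma exists_reflTransGen_cons {a b σ : Equiv.Perm α} {u : Multiset (Equiv.Perm α)} [Nonempty α]
    (hσ : edges π σ ≤ edgesSum π (a ::ₘ b ::ₘ u)) :
    ∃ s, Relation.ReflTransGen (Step π) (a ::ₘ b ::ₘ u) (σ ::ₘ s) := by
  obtain ⟨c, a', b', v, hE, hs⟩ := Reaches.of_injOn (X := a) (j := Classical.arbitrary α) hσ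
    ⟨b, a, b, u, rfl, .refl⟩ a.injective.injOn
  obtain ⟨c, rfl⟩ := exists_perm_eq (f := c) fun N => by
    have := congrArg (Multiset.countP fun p => p.2 ∈ N) hE
    simp only [Multiset.countP_add, countP_edges, card_filter_perm] at this
    omega
  refine ⟨c ::ₘ v, hs.tail ⟨a' ::ₘ b' ::ₘ 0, σ ::ₘ c ::ₘ 0, v, by simp, by simp, by simp, ?_⟩⟩
  simpa only [edgesSum_cons, edgesSum_zero, add_zero] using hE.symm

/-- Multisets of permutations with the same edges are connected by steps. -/
theorem reflTransGen_step [Nonempty α] {s t : Multiset (Equiv.Perm α)}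
    (h : edgesSum π s = edgesSum π t) :
    Relation.ReflTransGen (Step π) s t := by
  have hcard : Multiset.card s = Multiset.card t := by
    have := congrArg Multiset.card h
    rwa [card_edgesSum, card_edgesSum, Nat.mul_left_inj Fintype.card_ne_zero] at this
  induction t using Multiset.induction generalizing s with
  | empty =>
    rw [Multiset.card_zero, Multiset.card_eq_zero] at hcard
    rw [hcard]
  | cons σ t ih =>
    rw [Multiset.card_cons] at hcard
    obtain ⟨a, s, rfl⟩ := Multiset.card_pos_iff_exists_mem.mp (by omega : 0 < Multiset.card s)
      |>.imp fun a ha => Multiset.exists_cons_of_mem ha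
    rcases s.empty_or_exists_mem with rfl | ⟨b, hb⟩
    · have ht : t = 0 := by simpa [eq_comm] using hcard
      subst ht
      exact .single ⟨a ::ₘ 0, σ ::ₘ 0, 0, by simp, by simp, by simp, h⟩
    · obtain ⟨u, rfl⟩ := Multiset.exists_cons_of_mem hb
      obtain ⟨s', hs'⟩ := exists_reflTransGen_cons (π := π) (a := a) (b := b) (σ := σ) (u := u)
        (by rw [h, edgesSum_cons]; exact Multiset.le_add_right _ _)
      have hE := (edgesSum_eq_of_reflTransGen hs').symm.trans h
      have hc := congrArg Multiset.card hE
      rw [card_edgesSum, card_edgesSum, Nat.mul_left_inj Fintype.card_ne_zero,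
        Multiset.card_cons, Multiset.card_cons, Nat.add_right_cancel_iff] at hc
      rw [edgesSum_cons, edgesSum_cons, add_right_inj] at hE
      exact hs'.trans ((ih hE hc).lift (σ ::ₘ ·) fun _ _ => Step.cons σ)

end Rows

section Votes

variable {n r : ℕ}

/-- Positions of a permutation of `Fin n` beyond the first `r` are not distinguished. -/
def position (n r : ℕ) (j : Fin n) : Option (Fin r) :=
  if h : (j : ℕ) < r then some ⟨j, h⟩ else none

lemma position_eq_some (hrn : r ≤ n) {j : Fin n} {i : Fin r} :
    position n r j = some i ↔ j = Fin.castLE hrn i := by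
  unfold position
  split_ifs with h
  · simp [Fin.ext_iff]
  · simp only [false_iff]
    rintro rfl
    exact h i.2

/-- The injection formed by the first `r` values of a permutation. -/
def truncate (hrn : r ≤ n) (a : Equiv.Perm (Fin n)) : Fin r ↪ Fin n :=
  (Fin.castLEEmb hrn).trans a.toEmbedding

lemma truncate_surjective (hrn : r ≤ n) : Function.Surjective (truncate hrn) := fun τ => by
  obtain ⟨a, ha⟩ := Equiv.Perm.exists_extending_pair (Fin.castLE hrn) τ
    (Fin.castLE_injective hrn) τ.injective
  exact ⟨a, by ext j; simp [truncate, ha]⟩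

/-- The vector counting the truncations of a multiset of permutations. -/
def votes (hrn : r ≤ n) (s : Multiset (Equiv.Perm (Fin n))) (σ : Fin r ↪ Fin n) : ℕ :=
  (s.map (truncate hrn)).count σ

lemma exists_votes_eq (hrn : r ≤ n) (x : (Fin r ↪ Fin n) → ℕ) : ∃ s, votes hrn s = x := by
  refine ⟨(∑ σ, x σ • {σ} : Multiset (Fin r ↪ Fin n)).map
    (Function.surjInv (truncate_surjective hrn)), ?_⟩
  ext σ
  rw [votes, Multiset.map_map, Function.RightInverse.id
    (Function.rightInverse_surjInv (truncate_surjective hrn)), Multiset.map_id]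
  simp [Multiset.count_sum', Multiset.count_singleton]

lemma votes_add (hrn : r ≤ n) (s t : Multiset (Equiv.Perm (Fin n))) :
    votes hrn (s + t) = votes hrn s + votes hrn t := by
  ext σ
  simp [votes]

lemma suffN_add (x y : (Fin r ↪ Fin n) → ℕ) :
    suffN n r (x + y) = suffN n r x + suffN n r y := by
  ext p
  simp only [suffN, Pi.add_apply, ← Finset.sum_add_distrib]
  exact Finset.sum_congr rfl fun σ _ => by split_ifs <;> rfl

lemma suffZ_sub (x y : (Fin r ↪ Fin n) → ℕ) (p : Fin r × Fin n) :
    suffZ n r (fun σ => (x σ : ℤ) - y σ) p = suffN n r x p - suffN n r y p := by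
  simp only [suffZ, suffN, Nat.cast_sum, ← Finset.sum_sub_distrib]
  exact Finset.sum_congr rfl fun σ _ => by split_ifs <;> simp

lemma count_some_edges (hrn : r ≤ n) (a : Equiv.Perm (Fin n)) (i : Fin r) (k : Fin n) :
    (edges (position n r) a).count (some i, k) = if truncate hrn a i = k then 1 else 0 := by
  rw [edges, Multiset.count_sum', Finset.sum_eq_single (Fin.castLE hrn i)]
  · simp [Multiset.count_singleton, (position_eq_some hrn).mpr, truncate, eq_comm]
  · intro j _ hj
    rw [Multiset.count_singleton, if_neg]
    intro h
    exact hj ((position_eq_some hrn).mp (Prod.mk.inj h).1.symm)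
  · simp

lemma suffN_votes (hrn : r ≤ n) (s : Multiset (Equiv.Perm (Fin n))) (i : Fin r) (k : Fin n) :
    suffN n r (votes hrn s) (i, k) = (edgesSum (position n r) s).count (some i, k) := by
  induction s using Multiset.induction with
  | empty => simp [suffN, votes]
  | cons a s ih =>
    rw [← Multiset.singleton_add, votes_add, suffN_add, Pi.add_apply, ih,
      Multiset.singleton_add, edgesSum_cons, Multiset.count_add, count_some_edges hrn]
    congr 1
    rw [suffN, Finset.sum_eq_single (truncate hrn a)]
    · simp [votes]
    · intro σ _ hσ
      simp [votes, hσ]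
    · simp

lemma sum_count_edgesSum (s : Multiset (Equiv.Perm (Fin n))) (k : Fin n) :
    ∑ q, (edgesSum (position n r) s).count (q, k) = Multiset.card s := by
  induction s using Multiset.induction with
  | empty => simp
  | cons a s ih =>
    simp only [edgesSum_cons, Multiset.count_add, Finset.sum_add_distrib, ih, Multiset.card_cons]
    rw [add_comm, Nat.add_left_cancel_iff]
    simp only [edges, Multiset.count_sum', Multiset.count_singleton, Prod.mk.injEq]
    rw [Finset.sum_comm, Finset.sum_eq_single (a.symm k)]
    · simp
    · intro j _ hj
      refine Finset.sum_eq_zero fun q _ => if_neg fun h => hj ?_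
      simp [h.2]
    · simp

lemma sum_suffN_votes (hrn : r ≤ n) (s : Multiset (Equiv.Perm (Fin n))) (i : Fin r) :
    ∑ k, suffN n r (votes hrn s) (i, k) = Multiset.card s := by
  simp only [suffN]
  rw [Finset.sum_comm]
  simp only [Finset.sum_ite_eq, Finset.mem_univ, if_true, votes]
  rw [Multiset.sum_count_eq_card fun _ _ => Finset.mem_univ _, Multiset.card_map]

lemma edgesSum_eq_of_suffN_votes_eq (hrn : r ≤ n) (hr : 0 < r)
    {s t : Multiset (Equiv.Perm (Fin n))}
    (h : suffN n r (votes hrn s) = suffN n r (votes hrn t)) :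
    edgesSum (position n r) s = edgesSum (position n r) t := by
  have hsome (i : Fin r) (k : Fin n) : (edgesSum (position n r) s).count (some i, k) =
      (edgesSum (position n r) t).count (some i, k) := by
    rw [← suffN_votes hrn, ← suffN_votes hrn, h]
  ext ⟨_ | i, k⟩
  · have hs := sum_count_edgesSum (r := r) s k
    have ht := sum_count_edgesSum (r := r) t k
    rw [← sum_suffN_votes hrn _ ⟨0, hr⟩, Fintype.sum_option] at hs ht
    simp only [h, hsome] at hs
    omega
  · exact hsome i k

lemma moveDeg_votes_sub_le (hrn : r ≤ n) (A B u : Multiset (Equiv.Perm (Fin n))) :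
    moveDeg n r (fun σ => (votes hrn (B + u) σ : ℤ) - votes hrn (A + u) σ) ≤
      Multiset.card B := by
  calc _ ≤ ∑ σ, votes hrn B σ := Finset.sum_le_sum fun σ _ => by
        simp only [votes_add, Pi.add_apply]
        omega
    _ = _ := by
        simp only [votes]
        rw [Multiset.sum_count_eq_card fun _ _ => Finset.mem_univ _, Multiset.card_map]

end Votes

end BirkhoffModel

open BirkhoffModel

/-- For `2 ≤ r ≤ n` and `n ≥ 3`, any two elements of a common fiber of
`A_{n,r}` are connected by a path staying within the fiber each of whose steps is a move
(an element of the integer kernel of `A_{n,r}`) of degree at most three: the set of all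
moves of degree at most three is a Markov basis for `A_{n,r}`. -/
theorem markov_degree_le_three
    (n r : ℕ) (hr : 2 ≤ r) (hrn : r ≤ n) (hn : 3 ≤ n)
    (x y : (Fin r ↪ Fin n) → ℕ) (hxy : suffN n r x = suffN n r y) :
    ∃ (m : ℕ) (w : ℕ → (Fin r ↪ Fin n) → ℕ),
      w 0 = x ∧ w m = y ∧
      (∀ i ≤ m, suffN n r (w i) = suffN n r x) ∧
      (∀ i < m,
        suffZ n r (fun σ => (w (i+1) σ : ℤ) - (w i σ : ℤ)) = 0 ∧
        moveDeg n r (fun σ => (w (i+1) σ : ℤ) - (w i σ : ℤ)) ≤ 3) := by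
  have : Nonempty (Fin n) := ⟨⟨0, by omega⟩⟩
  obtain ⟨s, rfl⟩ := exists_votes_eq hrn x
  obtain ⟨t, rfl⟩ := exists_votes_eq hrn y
  obtain ⟨m, w, rfl, rfl, hw⟩ := exists_path_of_reflTransGen <|
    reflTransGen_step (edgesSum_eq_of_suffN_votes_eq hrn (by omega) hxy)
  have hsuff {s t} (h : Step (position n r) s t) :
      suffN n r (votes hrn t) = suffN n r (votes hrn s) := by
    ext ⟨i, k⟩
    rw [suffN_votes, suffN_votes, h.edgesSum_eq]
  refine ⟨m, fun i => votes hrn (w i), rfl, rfl, fun i hi => ?_, fun i hi => ⟨?_, ?_⟩⟩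
  · induction i with
    | zero => rfl
    | succ i ih => exact (hsuff (hw i (by omega))).trans (ih (by omega))
  · ext p
    rw [suffZ_sub, hsuff (hw i hi), sub_self, Pi.zero_apply]
  · obtain ⟨A, B, u, hA, hB, hcard, -⟩ := hw i hi
    simp only [hA, hB]
    exact (moveDeg_votes_sub_le hrn A B u).trans hcard
end

section
/- Let 1 ≤ r ≤ n. Let V₁ be an improper vote whose row j has entries 1 in columns b and c and entry −1 in column a, where a, b, c are distinct candidates in {1,…,n}, and let V₂ be a proper vote with entry 1 at cell (j, d) for some candidate d ∉ {a, b, c}. Then there exist an improper vote V₁' and a proper vote V₂' with V₁' + V₂' = V₁ + V₂ such that either row j of V₁' has entries 1 in columns b and d and −1 in column a while V₂' has entry 1 at cell (j, c), or row j of V₁' has entries 1 in columns c and d and −1 in column a while V₂' has entry 1 at cell (j, b). -/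
/-- A proper vote: an `r × n` integer matrix with all entries in `{0,1}`, every row sum
equal to `1`, and every column sum equal to `0` or `1`. -/
def IsProperVote (r n : ℕ) (V : Matrix (Fin r) (Fin n) ℤ) : Prop :=
  (∀ j k, V j k = 0 ∨ V j k = 1) ∧
  (∀ j, ∑ k, V j k = 1) ∧
  (∀ k, ∑ j, V j k = 0 ∨ ∑ j, V j k = 1)

/-- An improper vote: an `r × n` integer matrix with every row sum equal to `1`, every
column sum equal to `0` or `1`, exactly one entry equal to `-1`, and all other entries
in `{0,1}`. -/
def IsImproperVote (r n : ℕ) (V : Matrix (Fin r) (Fin n) ℤ) : Prop :=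
  (∀ j, ∑ k, V j k = 1) ∧
  (∀ k, ∑ j, V j k = 0 ∨ ∑ j, V j k = 1) ∧
  (∃ j' k', V j' k' = -1 ∧ ∀ j k, (j, k) ≠ (j', k') → V j k = 0 ∨ V j k = 1)

open Relation in
/-- In a partial injection `f`, given two roots `j ≠ j₀` and two disjoint sets `B`, `C` of sinks with
at most one element each, some union of components of `f` contains `j` but not `j₀`, and contains
one of `B`, `C` while avoiding the other. -/
theorem exists_separating_closed_set {ι : Type*} (f : ι → ι → Prop) (B C : ι → Prop) (j j₀ : ι)
    (hfun : ∀ x y z, f x y → f x z → y = z) (hinj : ∀ x y z, f x z → f y z → x = y)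
    (hj : ∀ x, ¬ f x j) (hj₀ : ∀ x, ¬ f x j₀) (hne : j ≠ j₀)
    (hB : ∀ p q, B p → ¬ f p q) (hC : ∀ p q, C p → ¬ f p q)
    (hB1 : ∀ p q, B p → B q → p = q) (hC1 : ∀ p q, C p → C q → p = q)
    (hBC : ∀ p, B p → ¬ C p) :
    ∃ T : Set ι, (∀ x y, f x y → (x ∈ T ↔ y ∈ T)) ∧ j ∈ T ∧ j₀ ∉ T ∧
      (((∀ p, B p → p ∉ T) ∧ ∀ p, C p → p ∈ T) ∨ ((∀ p, C p → p ∉ T) ∧ ∀ p, B p → p ∈ T)) := by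
  have root_eq : ∀ r s, (∀ x, ¬ f x s) → ReflTransGen f r s → s = r := by
    intro r s hs h
    rcases h.cases_tail with h | ⟨x, -, hx⟩
    · exact h
    · exact absurd hx (hs x)
  have sink_eq : ∀ p q, (∀ x, ¬ f p x) → ReflTransGen f p q → p = q := by
    intro p q hp h
    rcases h.cases_head with h | ⟨x, hx, -⟩
    · exact h
    · exact absurd hx (hp x)
  have same_sink : ∀ r p q, (∀ x, ¬ f p x) → (∀ x, ¬ f q x) →
      ReflTransGen f r p → ReflTransGen f r q → p = q := by
    intro r p q hp hq h h'
    rcases ReflTransGen.total_of_right_unique (fun x y z => hfun x y z) h h' with h | h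
    · exact sink_eq _ _ hp h
    · exact (sink_eq _ _ hq h).symm
  have same_root : ∀ p, ReflTransGen f j p → ReflTransGen f j₀ p → False := by
    intro p h h'
    rcases ReflTransGen.total_of_right_unique (r := Function.swap f)
      (fun x y z hy hz => hinj y z x hy hz) h.swap h'.swap with h | h
    · exact hne (root_eq _ _ hj h.swap)
    · exact hne (root_eq _ _ hj₀ h.swap).symm
  have build : ∀ B C : ι → Prop, (∀ p q, B p → ¬ f p q) → (∀ p q, C p → ¬ f p q) →
      (∀ p, B p → ¬ C p) → (∀ p, B p → ¬ ReflTransGen f j p) →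
      (∀ p, C p → ¬ ReflTransGen f j₀ p) →
      ∃ T : Set ι, (∀ x y, f x y → (x ∈ T ↔ y ∈ T)) ∧ j ∈ T ∧ j₀ ∉ T ∧
        ((∀ p, B p → p ∉ T) ∧ ∀ p, C p → p ∈ T) := by
    intro B C hB hC hBC hjB hjC
    refine ⟨{i | ¬ ((∃ p, B p ∧ ReflTransGen f i p) ∨ ReflTransGen f j₀ i)}, ?_, ?_, ?_, ?_, ?_⟩
    · intro x y hxy
      refine not_congr (or_congr ⟨?_, ?_⟩ ⟨fun h => h.tail hxy, ?_⟩)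
      · rintro ⟨p, hp, h⟩
        rcases h.cases_head with rfl | ⟨z, hz, h⟩
        · exact absurd hxy (hB _ _ hp)
        · exact ⟨p, hp, hfun _ _ _ hz hxy ▸ h⟩
      · rintro ⟨p, hp, h⟩
        exact ⟨p, hp, h.head hxy⟩
      · intro h
        rcases h.cases_tail with rfl | ⟨z, h, hz⟩
        · exact absurd hxy (hj₀ _)
        · exact hinj _ _ _ hz hxy ▸ h
    · rintro (⟨p, hp, h⟩ | h)
      · exact hjB p hp h
      · exact hne (root_eq _ _ hj h)
    · exact fun h => h (Or.inr .refl)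
    · exact fun p hp h => h (Or.inl ⟨p, hp, .refl⟩)
    · rintro q hq (⟨p, hp, h⟩ | h)
      · obtain rfl := sink_eq _ _ (fun x => hC q x hq) h
        exact hBC _ hp hq
      · exact hjC q hq h
  by_cases h : (∀ p, B p → ¬ ReflTransGen f j p) ∧ (∀ p, C p → ¬ ReflTransGen f j₀ p)
  · obtain ⟨T, h1, h2, h3, h4⟩ := build B C hB hC hBC h.1 h.2
    exact ⟨T, h1, h2, h3, Or.inl h4⟩
  · have hjC : ∀ p, C p → ¬ ReflTransGen f j p := by
      intro p hp hjp
      refine h ⟨fun q hq hjq => ?_, fun q hq hjq => ?_⟩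
      · obtain rfl := same_sink _ _ _ (fun x => hC p x hp) (fun x => hB q x hq) hjp hjq
        exact hBC _ hq hp
      · obtain rfl := hC1 _ _ hp hq
        exact same_root _ hjp hjq
    have hjB : ∀ p, B p → ¬ ReflTransGen f j₀ p := by
      intro p hp hjp
      refine h ⟨fun q hq hjq => ?_, fun q hq hjq => ?_⟩
      · obtain rfl := hB1 _ _ hp hq
        exact same_root _ hjq hjp
      · obtain rfl := same_sink _ _ _ (fun x => hB p x hp) (fun x => hC q x hq) hjp hjq
        exact hBC _ hp hq
    obtain ⟨T, h1, h2, h3, h4⟩ := build C B hC hB (fun p hc hb => hBC p hb hc) hjC hjB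
    exact ⟨T, h1, h2, h3, Or.inr h4⟩

theorem sum_eq_zero_or_one_of_subsingleton {ι : Type*} [Fintype ι] (g : ι → ℤ)
    (h01 : ∀ i, g i = 0 ∨ g i = 1) (h : ∀ i i', g i = 1 → g i' = 1 → i = i') :
    ∑ i, g i = 0 ∨ ∑ i, g i = 1 := by
  by_cases hex : ∃ i, g i = 1
  · obtain ⟨i, hi⟩ := hex
    right
    rw [Fintype.sum_eq_single i fun i' hi' => (h01 i').resolve_right fun h' => hi' (h _ _ h' hi), hi]
  · push Not at hex
    exact Or.inl (Finset.sum_eq_zero fun i _ => (h01 i).resolve_right (hex i))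

theorem eq_of_sum_le_one {ι : Type*} [Fintype ι] (g : ι → ℤ)
    (h01 : ∀ i, g i = 0 ∨ g i = 1) (h : ∑ i, g i ≤ 1) (i i' : ι) (hi : g i = 1) (hi' : g i' = 1) :
    i = i' := by
  classical
  by_contra hne
  have := Finset.sum_le_sum_of_subset_of_nonneg (f := g) (Finset.subset_univ {i, i'})
    fun x _ _ => by rcases h01 x with h | h <;> simp [h]
  rw [Finset.sum_pair hne, hi, hi'] at this
  omega

/-- Exchanging `d` in the second vote for `y` in the first one, in row `j`, and swapping the other
rows in `T`. -/
theorem improper_exchange_of_closed_set {r n : ℕ} {U V : Matrix (Fin r) (Fin n) ℤ}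
    {j j₀ : Fin r} {a x y d : Fin n} (T : Set (Fin r))
    (hxy : x ≠ y) (hax : a ≠ x) (hda : d ≠ a) (hdx : d ≠ x)
    (hj₀ : j₀ ≠ j) (hU01 : ∀ i k, U i k = 0 ∨ U i k = 1)
    (hUcol : ∀ k i i', U i k = 1 → U i' k = 1 → i = i')
    (hUj : ∀ k, U j k = (if k = x then 1 else 0) + (if k = y then 1 else 0))
    (hUj₀ : ∀ k, U j₀ k = 0)
    (hUrow : ∀ i, i ≠ j → i ≠ j₀ → ∑ k, U i k = 1)
    (hV01 : ∀ i k, V i k = 0 ∨ V i k = 1)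
    (hVcol : ∀ k i i', V i k = 1 → V i' k = 1 → i = i')
    (hVj : ∀ k, V j k = if k = d then 1 else 0)
    (hVrow : ∀ i, ∑ k, V i k = 1)
    (hT : ∀ i i' k, V i k = 1 → U i' k = 1 → i' ≠ j → (i ∈ T ↔ i' ∈ T))
    (hjT : j ∈ T) (hj₀T : j₀ ∉ T)
    (hx : ∀ p, V p x = 1 → p ∉ T) (hy : ∀ p, V p y = 1 → p ∈ T)
    (E : Matrix (Fin r) (Fin n) ℤ)
    (hE : ∀ i k, E i k = if k = a then (if i = j then -1 else if i = j₀ then 1 else 0) else 0) :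
    ∃ V₁' V₂' : Matrix (Fin r) (Fin n) ℤ,
      IsImproperVote r n V₁' ∧ IsProperVote r n V₂' ∧
      V₁' + V₂' = (U + E) + V ∧
      (V₁' j x = 1 ∧ V₁' j d = 1 ∧ V₁' j a = -1 ∧ V₂' j y = 1) := by
  classical
  let U' : Matrix (Fin r) (Fin n) ℤ := fun i k =>
    if i = j then (if k = x then 1 else 0) + (if k = d then 1 else 0)
    else if i ∈ T then V i k else U i k
  let V' : Matrix (Fin r) (Fin n) ℤ := fun i k =>
    if i = j then (if k = y then 1 else 0) else if i ∈ T then U i k else V i k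
  have U'j : ∀ k, U' j k = (if k = x then 1 else 0) + (if k = d then 1 else 0) := fun k => by
    simp [U']
  have U'T : ∀ i k, i ≠ j → i ∈ T → U' i k = V i k := fun i k h h' => by simp [U', h, h']
  have U'n : ∀ i k, i ≠ j → i ∉ T → U' i k = U i k := fun i k h h' => by simp [U', h, h']
  have V'j : ∀ k, V' j k = if k = y then 1 else 0 := fun k => by simp [V']
  have V'T : ∀ i k, i ≠ j → i ∈ T → V' i k = U i k := fun i k h h' => by simp [V', h, h']
  have V'n : ∀ i k, i ≠ j → i ∉ T → V' i k = V i k := fun i k h h' => by simp [V', h, h']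
  have U'01 : ∀ i k, U' i k = 0 ∨ U' i k = 1 := by
    intro i k; grind
  have V'01 : ∀ i k, V' i k = 0 ∨ V' i k = 1 := by
    intro i k; grind
  have U'colj : ∀ k i, U' j k = 1 → U' i k = 1 → i = j := by
    intro k i h h'
    by_contra hi
    have hk : k = x ∨ k = d := by grind
    by_cases hiT : i ∈ T
    · rw [U'T i k hi hiT] at h'
      rcases hk with rfl | rfl
      · exact hx i h' hiT
      · exact hi (hVcol k _ _ h' (by simp [hVj]))
    · rw [U'n i k hi hiT] at h'
      rcases hk with rfl | rfl
      · exact hi (hUcol k _ _ h' (by simp [hUj, hxy]))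
      · exact hiT ((hT j i k (by simp [hVj]) h' hi).1 hjT)
  have V'colj : ∀ k i, V' j k = 1 → V' i k = 1 → i = j := by
    intro k i h h'
    by_contra hi
    obtain rfl : k = y := by grind
    by_cases hiT : i ∈ T
    · rw [V'T i k hi hiT] at h'
      exact hi (hUcol k _ _ h' (by simp [hUj, hxy.symm]))
    · rw [V'n i k hi hiT] at h'
      exact hiT (hy i h')
  have U'col : ∀ k i i', U' i k = 1 → U' i' k = 1 → i = i' := by
    intro k i i' h h'
    by_cases hi : i = j
    · subst hi; exact (U'colj k i' h h').symm
    by_cases hi' : i' = j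
    · subst hi'; exact U'colj k i h' h
    grind
  have V'col : ∀ k i i', V' i k = 1 → V' i' k = 1 → i = i' := by
    intro k i i' h h'
    by_cases hi : i = j
    · subst hi; exact (V'colj k i' h h').symm
    by_cases hi' : i' = j
    · subst hi'; exact V'colj k i h' h
    grind
  have Ecol : ∀ k, ∑ i, E i k = 0 := by
    intro k
    by_cases hk : k = a
    · have : ∀ i, E i k = (if i = j then -1 else 0) + (if i = j₀ then 1 else 0) := by
        intro i; grind
      simp [this, Finset.sum_add_distrib]
    · simp [hE, hk]
  have Erow : ∀ i, ∑ k, E i k = if i = j then -1 else if i = j₀ then 1 else 0 := by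
    intro i
    simp [hE]
  refine ⟨U' + E, V', ⟨?_, ?_, j, a, ?_, ?_⟩, ⟨V'01, ?_, ?_⟩, ?_, ?_, ?_, ?_, ?_⟩
  · intro i
    simp only [Matrix.add_apply, Finset.sum_add_distrib, Erow]
    by_cases hi : i = j
    · subst hi; simp [U'j, Finset.sum_add_distrib]
    by_cases hi₀ : i = j₀
    · subst hi₀
      simp [U'n _ _ hi hj₀T, hUj₀, hi]
    by_cases hiT : i ∈ T
    · simp [U'T _ _ hi hiT, hVrow, hi, hi₀]
    · simp [U'n _ _ hi hiT, hUrow i hi hi₀, hi, hi₀]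
  · intro k
    simp only [Matrix.add_apply, Finset.sum_add_distrib, Ecol, add_zero]
    exact sum_eq_zero_or_one_of_subsingleton _ (U'01 · k) (U'col k)
  · simp [U'j, hE, hax, hda.symm]
  · intro i k hik
    rw [Matrix.add_apply]
    by_cases hk : k = a
    · subst hk
      by_cases hi₀ : i = j₀
      · subst hi₀
        simp [U'n _ _ hj₀ hj₀T, hUj₀, hE, hj₀]
      · have hi : i ≠ j := fun h => hik (by rw [h])
        simpa [hE, hi, hi₀] using U'01 i k
    · simpa [hE, hk] using U'01 i k
  · intro i
    by_cases hi : i = j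
    · subst hi; simp [V'j]
    by_cases hiT : i ∈ T
    · have hi₀ : i ≠ j₀ := fun h => hj₀T (h ▸ hiT)
      simp [V'T _ _ hi hiT, hUrow i hi hi₀]
    · simp [V'n _ _ hi hiT, hVrow]
  · exact fun k => sum_eq_zero_or_one_of_subsingleton _ (V'01 · k) (V'col k)
  · ext i k
    simp only [Matrix.add_apply]
    grind
  · simp [U'j, hE, hax.symm, hdx.symm]
  · simp [U'j, hE, hda, hdx]
  · simp [U'j, hE, hax, hda.symm]
  · simp [V'j]

/-- Let `1 ≤ r ≤ n`, let `V₁` be an improper vote whose row `j` has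
entries `1` in columns `b` and `c` and entry `-1` in column `a` (with `a,b,c` distinct),
and let `V₂` be a proper vote with entry `1` at `(j, d)` for some `d ∉ {a,b,c}`. Then
there are an improper vote `V₁'` and a proper vote `V₂'` with `V₁' + V₂' = V₁ + V₂`
such that either row `j` of `V₁'` has entries `1` in columns `b, d` and `-1` in column
`a` while `V₂' j c = 1`, or row `j` of `V₁'` has entries `1` in columns `c, d` and `-1`
in column `a` while `V₂' j b = 1`. -/
theorem improper_exchange_d
    (r n : ℕ) (hr : 1 ≤ r) (hrn : r ≤ n)
    (V₁ V₂ : Matrix (Fin r) (Fin n) ℤ)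
    (h₁ : IsImproperVote r n V₁) (h₂ : IsProperVote r n V₂)
    (j : Fin r) (a b c d : Fin n)
    (hab : a ≠ b) (hac : a ≠ c) (hbc : b ≠ c)
    (hda : d ≠ a) (hdb : d ≠ b) (hdc : d ≠ c)
    (h1b : V₁ j b = 1) (h1c : V₁ j c = 1) (h1a : V₁ j a = -1)
    (h2d : V₂ j d = 1) :
    ∃ V₁' V₂' : Matrix (Fin r) (Fin n) ℤ,
      IsImproperVote r n V₁' ∧ IsProperVote r n V₂' ∧
      V₁' + V₂' = V₁ + V₂ ∧
      ((V₁' j b = 1 ∧ V₁' j d = 1 ∧ V₁' j a = -1 ∧ V₂' j c = 1) ∨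
       (V₁' j c = 1 ∧ V₁' j d = 1 ∧ V₁' j a = -1 ∧ V₂' j b = 1)) := by
  classical
  obtain ⟨hrow, hcol, j', k', -, h01'⟩ := h₁
  obtain ⟨hV01, hVrow, hVcolsum⟩ := h₂
  have hja : (j', k') = (j, a) := by
    by_contra h
    rcases h01' j a (Ne.symm h) with h | h <;> omega
  rw [hja] at h01'
  have h01 : ∀ i k, i ≠ j ∨ k ≠ a → V₁ i k = 0 ∨ V₁ i k = 1 := by
    intro i k h
    apply h01'
    rw [Ne, Prod.mk.injEq]
    tauto
  have hVcol : ∀ k i i', V₂ i k = 1 → V₂ i' k = 1 → i = i' := fun k =>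
    eq_of_sum_le_one _ (hV01 · k) (by rcases hVcolsum k with h | h <;> omega)
  have hVuniq : ∀ i k k', V₂ i k = 1 → V₂ i k' = 1 → k = k' := fun i =>
    eq_of_sum_le_one _ (hV01 i) (hVrow i).le
  have hVj : ∀ k, V₂ j k = if k = d then 1 else 0 := by
    intro k
    have := hVuniq j k d
    have := hV01 j k
    grind
  have hV₁j : ∀ k, V₁ j k = (if k = b then 1 else 0) + (if k = c then 1 else 0) -
      (if k = a then 1 else 0) := by
    intro k
    let g : Fin n → ℤ := fun k =>
      V₁ j k + (if k = a then 1 else 0) - (if k = b then 1 else 0)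
    have hg : ∀ k, g k = V₁ j k + (if k = a then 1 else 0) - (if k = b then 1 else 0) :=
      fun _ => rfl
    have hg01 : ∀ k, g k = 0 ∨ g k = 1 := by
      intro k
      have := h01 j k
      grind
    have hgsum : ∑ k, g k = 1 := by
      simp [g, Finset.sum_add_distrib, Finset.sum_sub_distrib, hrow]
    have := eq_of_sum_le_one g hg01 hgsum.le k c
    have := hg01 k
    grind
  obtain ⟨j₀, hj₀, hj₀a⟩ : ∃ j₀, j₀ ≠ j ∧ V₁ j₀ a = 1 := by
    by_contra! h
    have hsum : ∑ i, V₁ i a = -1 := by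
      rw [Fintype.sum_eq_single j fun i hi => (h01 i a (Or.inl hi)).resolve_right (h i hi), h1a]
    rcases hcol a with h | h <;> omega
  have hV₁uniq : ∀ i k k', i ≠ j → V₁ i k = 1 → V₁ i k' = 1 → k = k' := fun i k k' hi =>
    eq_of_sum_le_one _ (fun k => h01 i k (Or.inl hi)) (hrow i).le k k'
  let E : Matrix (Fin r) (Fin n) ℤ := fun i k =>
    if k = a then (if i = j then -1 else if i = j₀ then 1 else 0) else 0
  have hE : ∀ i k, E i k =
      if k = a then (if i = j then -1 else if i = j₀ then 1 else 0) else 0 := fun _ _ => rfl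
  have hEcol : ∀ k, ∑ i, E i k = 0 := by
    intro k
    by_cases hk : k = a
    · have : ∀ i, E i k = (if i = j then -1 else 0) + (if i = j₀ then 1 else 0) := by
        intro i; grind
      simp [this, Finset.sum_add_distrib]
    · simp [hE, hk]
  obtain ⟨U, hU⟩ : ∃ U : Matrix (Fin r) (Fin n) ℤ, V₁ = U + E := ⟨V₁ - E, by simp⟩
  have hUE : ∀ i k, V₁ i k = U i k + E i k := fun i k => by rw [hU, Matrix.add_apply]
  have hUj : ∀ k, U j k = (if k = b then 1 else 0) + (if k = c then 1 else 0) := by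
    intro k
    grind
  have hUj₀ : ∀ k, U j₀ k = 0 := by
    intro k
    have := hV₁uniq j₀ k a hj₀
    have := h01 j₀ k (Or.inl hj₀)
    grind
  have hUV : ∀ i k, i ≠ j → i ≠ j₀ → U i k = V₁ i k := by
    intro i k hi hi₀
    simp [hUE, hE, hi, hi₀]
  have hU01 : ∀ i k, U i k = 0 ∨ U i k = 1 := by
    intro i k
    have := h01 i k
    grind
  have hUcol : ∀ k i i', U i k = 1 → U i' k = 1 → i = i' := by
    intro k
    apply eq_of_sum_le_one _ (hU01 · k)
    have : ∑ i, V₁ i k = ∑ i, U i k := by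
      simp only [hUE, Finset.sum_add_distrib, hEcol, add_zero]
    rcases hcol k with h | h <;> omega
  have hUrow : ∀ i, i ≠ j → i ≠ j₀ → ∑ k, U i k = 1 := by
    intro i hi hi₀
    simp only [hUV i _ hi hi₀, hrow]
  have hUuniq : ∀ i k k', i ≠ j → U i k = 1 → U i k' = 1 → k = k' := by
    intro i k k' hi h h'
    have hi₀ : i ≠ j₀ := by
      rintro rfl
      simp [hUj₀] at h
    exact hV₁uniq i k k' hi (hUV i k hi hi₀ ▸ h) (hUV i k' hi hi₀ ▸ h')
  have hUjb : U j b = 1 := by simp [hUj, hbc]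
  have hUjc : U j c = 1 := by simp [hUj, hbc.symm]
  obtain ⟨T, hT, hjT, hj₀T, hbc'⟩ := exists_separating_closed_set
    (fun i i' => i' ≠ j ∧ ∃ k, V₂ i k = 1 ∧ U i' k = 1) (fun p => V₂ p b = 1)
    (fun p => V₂ p c = 1) j j₀
    (by
      rintro i i' i'' ⟨-, k, hk, hk'⟩ ⟨-, l, hl, hl'⟩
      obtain rfl := hVuniq i k l hk hl
      exact hUcol k _ _ hk' hl')
    (by
      rintro i i' i'' ⟨hi, k, hk, hk'⟩ ⟨-, l, hl, hl'⟩
      obtain rfl := hUuniq _ k l hi hk' hl'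
      exact hVcol k _ _ hk hl)
    (fun i h => h.1 rfl)
    (by
      rintro i ⟨-, k, -, hk⟩
      simp [hUj₀] at hk)
    hj₀.symm
    (by
      rintro p q hp ⟨hq, k, hk, hk'⟩
      obtain rfl := hVuniq p _ _ hp hk
      exact hq (hUcol _ _ _ hk' hUjb))
    (by
      rintro p q hp ⟨hq, k, hk, hk'⟩
      obtain rfl := hVuniq p _ _ hp hk
      exact hq (hUcol _ _ _ hk' hUjc))
    (hVcol b) (hVcol c) (fun p hp hp' => hbc (hVuniq p _ _ hp hp'))
  have hT' : ∀ i i' k, V₂ i k = 1 → U i' k = 1 → i' ≠ j → (i ∈ T ↔ i' ∈ T) :=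
    fun i i' k h h' hi' => hT i i' ⟨hi', k, h, h'⟩
  rw [hU]
  rcases hbc' with ⟨hb, hc⟩ | ⟨hc, hb⟩
  · obtain ⟨W₁, W₂, hW₁, hW₂, hW, h⟩ := improper_exchange_of_closed_set T hbc hab hda hdb hj₀
      hU01 hUcol hUj hUj₀ hUrow hV01 hVcol hVj hVrow hT' hjT hj₀T hb hc E hE
    exact ⟨W₁, W₂, hW₁, hW₂, hW, Or.inl h⟩
  · obtain ⟨W₁, W₂, hW₁, hW₂, hW, h⟩ := improper_exchange_of_closed_set T hbc.symm hac hda hdc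
      hj₀ hU01 hUcol (fun k => (hUj k).trans (add_comm _ _)) hUj₀ hUrow hV01 hVcol hVj hVrow
      hT' hjT hj₀T hc hb E hE
    exact ⟨W₁, W₂, hW₁, hW₂, hW, Or.inr h⟩
end

section
/- For every integer n ≥ 3, every minimal Markov basis for A_{n,3} contains exactly 18·C(n,4) + 270·C(n,5) + 270·C(n,6) moves of degree two, where C(n,k) denotes the binomial coefficient n choose k. -/
/-- `B` is a Markov basis for `A_{n,r}`: a finite set of moves (elements of the integer
kernel of `A_{n,r}`) such that any two points of a common fiber are connected by a path
staying in the fiber whose steps are elements of `B ∪ (-B)`. -/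
def IsMarkovBasis (n r : ℕ) (B : Finset ((Fin r ↪ Fin n) → ℤ)) : Prop :=
  (∀ z ∈ B, suffZ n r z = 0) ∧
  ∀ x y : (Fin r ↪ Fin n) → ℕ, suffN n r x = suffN n r y →
    ∃ (m : ℕ) (w : ℕ → (Fin r ↪ Fin n) → ℕ),
      w 0 = x ∧ w m = y ∧
      (∀ i ≤ m, suffN n r (w i) = suffN n r x) ∧
      (∀ i < m, (fun σ => (w (i+1) σ : ℤ) - (w i σ : ℤ)) ∈ B ∨
                (fun σ => (w i σ : ℤ) - (w (i+1) σ : ℤ)) ∈ B)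

theorem SimpleGraph.IsAcyclic.card_edgeFinset_add_card_connectedComponent {V : Type*} [Fintype V]
    {G : SimpleGraph V} [Fintype G.edgeSet] [Fintype G.ConnectedComponent] (hG : G.IsAcyclic) :
    G.edgeFinset.card + Fintype.card G.ConnectedComponent = Fintype.card V := by
  classical
  have hdeg (c : G.ConnectedComponent) :
      ∑ v ∈ Finset.univ.filter (fun v => G.connectedComponentMk v = c), G.degree v + 2
        = 2 * (Finset.univ.filter fun v => G.connectedComponentMk v = c).card := by
    have htree := (hG.isTree_connectedComponent c).card_edgeFinset
    have hsum := c.toSimpleGraph.sum_degrees_eq_twice_card_edges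
    have hcard : (Finset.univ.filter fun v => G.connectedComponentMk v = c).card
        = Fintype.card c := (Fintype.card_subtype _).symm
    have hd : ∑ v ∈ Finset.univ.filter (fun v => G.connectedComponentMk v = c), G.degree v
        = ∑ v : c, c.toSimpleGraph.degree v := by
      rw [Finset.sum_subtype (p := fun v => v ∈ c.supp) _ (by simp)]
      refine Finset.sum_congr rfl fun v _ => ?_
      symm
      have hv : G.neighborSet v ⊆ c.supp := by
        intro w hw
        exact (c.mem_supp_congr_adj hw).1 v.2
      rw [← SimpleGraph.degree_induce_of_neighborSet_subset hv]
      congr!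
    rw [hd, hsum, hcard, ← htree]
    ring
  have hE : ∑ v, G.degree v = 2 * G.edgeFinset.card := by
    convert G.sum_degrees_eq_twice_card_edges
  have h1 := Finset.sum_fiberwise Finset.univ G.connectedComponentMk (fun v => G.degree v)
  have h2 := Finset.card_eq_sum_card_fiberwise (s := Finset.univ) (t := Finset.univ)
    (f := G.connectedComponentMk) (fun _ _ => Finset.mem_coe.2 (Finset.mem_univ _))
  have h3 := Finset.sum_congr rfl fun c (_ : c ∈ Finset.univ) => hdeg c
  rw [Finset.sum_add_distrib, ← Finset.mul_sum, h1, ← h2, hE] at h3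
  simp only [Finset.sum_const, Finset.card_univ, smul_eq_mul] at h3
  lia

/-- The sum of `Φ` over all extensions of the list `g` by `j` entries smaller than `n`. -/
def extSum (n : ℕ) (Φ : List ℕ → ℤ) : ℕ → List ℕ → ℤ
  | 0, g => Φ g
  | j + 1, g => ∑ a ∈ Finset.range n, extSum n Φ j (g ++ [a])

/-- The sum of `Φ` over the extensions of `g`, a list with entries smaller than `k`, by `j`
entries in which new entries are numbered `k, k + 1, …` in order of first appearance and exactly
the entries smaller than `K` occur in the end. -/
def extCoeff (Φ : List ℕ → ℤ) : ℕ → List ℕ → ℕ → ℕ → ℤ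
  | 0, g, k, K => if k = K then Φ g else 0
  | j + 1, g, k, K =>
      ∑ i ∈ Finset.range k, extCoeff Φ j (g ++ [i]) k K + extCoeff Φ j (g ++ [k]) (k + 1) K

theorem extSum_map {n : ℕ} {Φ : List ℕ → ℤ}
    (hΦ : ∀ (π : Equiv.Perm ℕ) l, Φ (l.map π) = Φ l) (π : Equiv.Perm ℕ)
    (hπ : ∀ a, a < n ↔ π a < n) (j : ℕ) (g : List ℕ) :
    extSum n Φ j (g.map π) = extSum n Φ j g := by
  induction j generalizing g with
  | zero => exact hΦ π g
  | succ j ih =>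
    simp only [extSum]
    symm
    refine Finset.sum_equiv π (by simpa using hπ) fun a _ => ?_
    rw [← ih, List.map_append, List.map_singleton]

theorem descFactorial_mul_extSum_succ {n : ℕ} {Φ : List ℕ → ℤ}
    (hΦ : ∀ (π : Equiv.Perm ℕ) l, Φ (l.map π) = Φ l) (j k : ℕ) (g : List ℕ)
    (hg : ∀ a ∈ g, a < k) :
    (n.descFactorial k : ℤ) * extSum n Φ (j + 1) g =
      ∑ i ∈ Finset.range k, (n.descFactorial k : ℤ) * extSum n Φ j (g ++ [i]) +
        (n.descFactorial (k + 1) : ℤ) * extSum n Φ j (g ++ [k]) := by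
  rcases lt_or_ge n k with h | h
  · simp [Nat.descFactorial_of_lt h]
  have hfresh : ∀ a ∈ Finset.Ico k n, extSum n Φ j (g ++ [a]) = extSum n Φ j (g ++ [k]) := by
    intro a ha
    rw [Finset.mem_Ico] at ha
    have hmap : (g ++ [k]).map (Equiv.swap k a) = g ++ [a] := by
      rw [List.map_append, List.map_singleton, Equiv.swap_apply_left]
      congr 1
      refine (List.map_congr_left fun b hb => ?_).trans (List.map_id g)
      have := hg b hb
      exact Equiv.swap_apply_of_ne_of_ne (by lia) (by lia)
    rw [← hmap]
    refine extSum_map hΦ _ (fun b => ?_) _ _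
    rw [Equiv.swap_apply_def]
    split_ifs <;> lia
  rw [extSum, ← Finset.sum_range_add_sum_Ico _ h, Finset.sum_congr rfl hfresh, Finset.sum_const,
    Nat.card_Ico, mul_add, Finset.mul_sum, Nat.descFactorial_succ, nsmul_eq_mul]
  push_cast
  ring

theorem descFactorial_mul_extSum {n : ℕ} {Φ : List ℕ → ℤ}
    (hΦ : ∀ (π : Equiv.Perm ℕ) l, Φ (l.map π) = Φ l) {M : ℕ} (j k : ℕ) (g : List ℕ)
    (hg : ∀ a ∈ g, a < k) (hM : k + j ≤ M) :
    (n.descFactorial k : ℤ) * extSum n Φ j g =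
      ∑ K ∈ Finset.range (M + 1), extCoeff Φ j g k K * n.descFactorial K := by
  induction j generalizing k g with
  | zero =>
    have : k < M + 1 := by lia
    simp [extSum, extCoeff, this, mul_comm]
  | succ j ih =>
    rw [descFactorial_mul_extSum_succ hΦ j k g hg, ih (k + 1) _ ?_ (by lia)]
    · rw [Finset.sum_congr rfl fun i hi => ih k (g ++ [i]) ?_ (by lia)]
      · rw [Finset.sum_comm, ← Finset.sum_add_distrib]
        refine Finset.sum_congr rfl fun K _ => ?_
        rw [← Finset.sum_mul, ← add_mul, extCoeff]
      · intro a ha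
        rw [Finset.mem_range] at hi
        rcases List.mem_append.1 ha with ha | ha
        · exact hg a ha
        · simp_all
    · intro a ha
      rcases List.mem_append.1 ha with ha | ha
      · exact (hg a ha).trans (Nat.lt_succ_self k)
      · simp_all

/-- The pairs `{a₀, b₀}`, `{a₁, b₁}`, `{a₂, b₂}` are the coordinatewise pairs of values of two
injective triples. -/
def Splits {α : Type*} (a₀ b₀ a₁ b₁ a₂ b₂ : α) : Prop :=
  [a₀, a₁, a₂].Nodup ∧ [b₀, b₁, b₂].Nodup ∨ [a₀, b₁, a₂].Nodup ∧ [b₀, a₁, b₂].Nodup ∨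
    [a₀, a₁, b₂].Nodup ∧ [b₀, b₁, a₂].Nodup ∨ [a₀, b₁, b₂].Nodup ∧ [b₀, a₁, a₂].Nodup

instance {α : Type*} [DecidableEq α] (a₀ b₀ a₁ b₁ a₂ b₂ : α) :
    Decidable (Splits a₀ b₀ a₁ b₁ a₂ b₂) := by
  unfold Splits; infer_instance

/-- Two divided by the number of ordered pairs with the same underlying unordered pair. -/
def diagWeight {α : Type*} [DecidableEq α] (a b : α) : ℤ := if a = b then 2 else 1

/-- The weight of a sextuple `a₀, b₀, a₁, b₁, a₂, b₂`: the product of the three `diagWeight`s if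
the sextuple splits into two injective triples, and zero otherwise. -/
def splitWeight : List ℕ → ℤ
  | [a₀, b₀, a₁, b₁, a₂, b₂] =>
    if Splits a₀ b₀ a₁ b₁ a₂ b₂ then diagWeight a₀ b₀ * diagWeight a₁ b₁ * diagWeight a₂ b₂ else 0
  | _ => 0

theorem splitWeight_map (π : Equiv.Perm ℕ) (l : List ℕ) :
    splitWeight (l.map π) = splitWeight l := by
  unfold splitWeight
  match l with
  | [] | [_] | [_, _] | [_, _, _] | [_, _, _, _] | [_, _, _, _, _]
  | _ :: _ :: _ :: _ :: _ :: _ :: _ :: _ => rfl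
  | [a₀, b₀, a₁, b₁, a₂, b₂] => simp [Splits, diagWeight]


theorem extCoeff_splitWeight :
    ∀ K, K < 7 → extCoeff splitWeight 6 [] 0 K =
      if K = 3 then 28 else if K = 4 then 66 else if K = 5 then 18 else if K = 6 then 1 else 0 := by
  decide +kernel

theorem extSum_splitWeight (n : ℕ) :
    extSum n splitWeight 6 [] = 28 * n.descFactorial 3 + 66 * n.descFactorial 4 +
      18 * n.descFactorial 5 + n.descFactorial 6 := by
  have h := descFactorial_mul_extSum (n := n) (M := 6) splitWeight_map 6 0 [] (by simp) (by simp)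
  rw [Nat.descFactorial_zero, Nat.cast_one, one_mul] at h
  rw [h, Finset.sum_congr rfl fun K hK => by
    rw [extCoeff_splitWeight K (Finset.mem_range.1 hK)]]
  simp [Finset.sum_range_succ]

theorem sum_diagWeight_mul {α : Type*} [Fintype α] [DecidableEq α] (G : Sym2 α → ℤ) :
    ∑ a, ∑ b, diagWeight a b * G s(a, b) = 2 * ∑ s, G s := by
  rw [← Fintype.sum_prod_type' (f := fun a b => diagWeight a b * G s(a, b)),
    ← Finset.sum_fiberwise Finset.univ (fun p : α × α => s(p.1, p.2)), Finset.mul_sum]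
  refine Finset.sum_congr rfl fun s _ => ?_
  induction s using Sym2.inductionOn with
  | hf x y =>
    have hfib : (Finset.univ.filter fun p : α × α => s(p.1, p.2) = s(x, y)) = {(x, y), (y, x)} := by
      ext ⟨a, b⟩
      simp
    rw [hfib]
    rcases eq_or_ne x y with rfl | hxy
    · simp [diagWeight]
    · rw [Finset.sum_pair (by simp [hxy])]
      simp only [diagWeight, hxy, hxy.symm, if_false, Sym2.eq_swap (a := y)]
      ring

/-- The coordinatewise unordered pairs of values of a pair of injections. -/
def coordPairs {n : ℕ} : Sym2 (Fin 3 ↪ Fin n) → Sym2 (Fin n) × Sym2 (Fin n) × Sym2 (Fin n) :=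
  Sym2.lift ⟨fun σ τ => (s(σ 0, τ 0), s(σ 1, τ 1), s(σ 2, τ 2)), fun σ τ => by
    simp [Sym2.eq_swap]⟩

@[simp]
theorem coordPairs_mk {n : ℕ} (σ τ : Fin 3 ↪ Fin n) :
    coordPairs s(σ, τ) = (s(σ 0, τ 0), s(σ 1, τ 1), s(σ 2, τ 2)) := rfl

theorem exists_embedding_of_nodup {α : Type*} {a b c : α} (h : [a, b, c].Nodup) :
    ∃ σ : Fin 3 ↪ α, σ 0 = a ∧ σ 1 = b ∧ σ 2 = c :=
  ⟨⟨_, List.nodup_iff_injective_get.1 h⟩, rfl, rfl, rfl⟩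

theorem nodup_embedding {α : Type*} (σ : Fin 3 ↪ α) : [σ 0, σ 1, σ 2].Nodup := by
  simp [σ.injective.eq_iff]

theorem exists_coordPairs_eq_iff {n : ℕ} (a₀ b₀ a₁ b₁ a₂ b₂ : Fin n) :
    (∃ p, coordPairs p = (s(a₀, b₀), s(a₁, b₁), s(a₂, b₂))) ↔ Splits a₀ b₀ a₁ b₁ a₂ b₂ := by
  constructor
  · rintro ⟨p, hp⟩
    induction p using Sym2.inductionOn with
    | hf σ τ =>
      have hσ := nodup_embedding σ
      have hτ := nodup_embedding τ
      simp only [coordPairs_mk, Prod.mk.injEq, Sym2.eq_iff] at hp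
      unfold Splits
      obtain ⟨⟨h0, h0'⟩ | ⟨h0, h0'⟩, ⟨h1, h1'⟩ | ⟨h1, h1'⟩, ⟨h2, h2'⟩ | ⟨h2, h2'⟩⟩ := hp <;>
        rw [h0, h1, h2] at hσ <;> rw [h0', h1', h2'] at hτ <;> tauto
  · rintro (⟨h, h'⟩ | ⟨h, h'⟩ | ⟨h, h'⟩ | ⟨h, h'⟩) <;>
    · obtain ⟨σ, h0, h1, h2⟩ := exists_embedding_of_nodup h
      obtain ⟨τ, h0', h1', h2'⟩ := exists_embedding_of_nodup h'
      exact ⟨s(σ, τ), by simp [h0, h1, h2, h0', h1', h2']⟩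

theorem extSum_splitWeight_eq_sum (n : ℕ) :
    extSum n splitWeight 6 [] = ∑ a₀ : Fin n, ∑ b₀ : Fin n, ∑ a₁ : Fin n, ∑ b₁ : Fin n,
      ∑ a₂ : Fin n, ∑ b₂ : Fin n, if Splits a₀ b₀ a₁ b₁ a₂ b₂ then
        diagWeight a₀ b₀ * diagWeight a₁ b₁ * diagWeight a₂ b₂ else 0 := by
  simp only [extSum, Finset.sum_range]
  simp [splitWeight, Splits, diagWeight, Fin.val_inj]

theorem eight_mul_card_range_coordPairs (n : ℕ) :
    8 * (Nat.card (Set.range (coordPairs (n := n))) : ℤ) =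
      28 * n.descFactorial 3 + 66 * n.descFactorial 4 +
        18 * n.descFactorial 5 + n.descFactorial 6 := by
  classical
  rw [← extSum_splitWeight, extSum_splitWeight_eq_sum]
  have hcard : (Nat.card (Set.range (coordPairs (n := n))) : ℤ) =
      ∑ t, if ∃ p, coordPairs (n := n) p = t then 1 else 0 := by
    rw [Finset.sum_boole, ← Fintype.card_subtype, ← Nat.card_eq_fintype_card]
    rfl
  have hsplit : (∑ a₀ : Fin n, ∑ b₀ : Fin n, ∑ a₁ : Fin n, ∑ b₁ : Fin n,
      ∑ a₂ : Fin n, ∑ b₂ : Fin n, if Splits a₀ b₀ a₁ b₁ a₂ b₂ then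
        diagWeight a₀ b₀ * diagWeight a₁ b₁ * diagWeight a₂ b₂ else 0) =
      ∑ a₀ : Fin n, ∑ b₀ : Fin n, diagWeight a₀ b₀ * ∑ a₁ : Fin n, ∑ b₁ : Fin n,
        diagWeight a₁ b₁ * ∑ a₂ : Fin n, ∑ b₂ : Fin n, diagWeight a₂ b₂ *
          if ∃ p, coordPairs p = (s(a₀, b₀), s(a₁, b₁), s(a₂, b₂)) then 1 else 0 := by
    simp only [Finset.mul_sum, exists_coordPairs_eq_iff, mul_ite, mul_one, mul_zero, mul_assoc]
  rw [hsplit, hcard, sum_diagWeight_mul fun s₀ => ∑ a₁ : Fin n, ∑ b₁ : Fin n,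
    diagWeight a₁ b₁ * ∑ a₂ : Fin n, ∑ b₂ : Fin n, diagWeight a₂ b₂ *
      if ∃ p, coordPairs p = (s₀, s(a₁, b₁), s(a₂, b₂)) then 1 else 0]
  simp_rw [fun s₀ => sum_diagWeight_mul fun s₁ => ∑ a₂ : Fin n, ∑ b₂ : Fin n,
    diagWeight a₂ b₂ * if ∃ p, coordPairs p = (s₀, s₁, s(a₂, b₂)) then 1 else 0,
    fun s₀ s₁ => sum_diagWeight_mul fun s₂ : Sym2 (Fin n) =>
      if ∃ p, coordPairs p = (s₀, s₁, s₂) then 1 else 0, Fintype.sum_prod_type, ← Finset.mul_sum]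
  ring

theorem two_mul_card_sym2_embedding (n : ℕ) :
    2 * (Fintype.card (Sym2 (Fin 3 ↪ Fin n)) : ℤ) =
      n.descFactorial 3 * (n.descFactorial 3 + 1) := by
  rw [Sym2.card, Fintype.card_embedding_eq, Fintype.card_fin, Fintype.card_fin,
    Nat.choose_two_right, Nat.add_sub_cancel]
  norm_cast
  rw [mul_comm (_ + 1), Nat.mul_div_cancel' (Nat.even_mul_succ_self _).two_dvd]

theorem card_sym2_sub_card_range_coordPairs (n : ℕ) :
    Fintype.card (Sym2 (Fin 3 ↪ Fin n)) = 18 * n.choose 4 + 270 * n.choose 5 + 270 * n.choose 6 +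
      Nat.card (Set.range (coordPairs (n := n))) := by
  have hV := two_mul_card_sym2_embedding n
  have hR := eight_mul_card_range_coordPairs n
  have h4 := n.descFactorial_eq_factorial_mul_choose 4
  have h5 := n.descFactorial_eq_factorial_mul_choose 5
  have h6 := n.descFactorial_eq_factorial_mul_choose 6
  have hmul : (n.descFactorial 3 : ℤ) * n.descFactorial 3 = n.descFactorial 6 +
      9 * n.descFactorial 5 + 18 * n.descFactorial 4 + 6 * n.descFactorial 3 := by
    simp only [← descPochhammer_eval_eq_descFactorial, descPochhammer_succ_right,
      descPochhammer_zero]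
    simp
    ring
  simp only [Nat.factorial] at h4 h5 h6
  zify at h4 h5 h6 ⊢
  linarith

/-- `x` and `y` differ by a move of `B` or its negative. -/
def MarkovStep {S : Type*} (B : Finset (S → ℤ)) (x y : S → ℕ) : Prop :=
  (fun σ => (y σ : ℤ) - x σ) ∈ B ∨ (fun σ => (x σ : ℤ) - y σ) ∈ B

namespace MarkovStep

variable {S : Type*} {B : Finset (S → ℤ)} {x y : S → ℕ}

theorem symm (h : MarkovStep B x y) : MarkovStep B y x := Or.symm h

theorem reflTransGen_symm (h : Relation.ReflTransGen (MarkovStep B) x y) :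
    Relation.ReflTransGen (MarkovStep B) y x := by
  induction h with
  | refl => exact .refl
  | tail _ h ih => exact .head h.symm ih

theorem reflTransGen_add (c : S → ℕ) (h : Relation.ReflTransGen (MarkovStep B) x y) :
    Relation.ReflTransGen (MarkovStep B) (x + c) (y + c) :=
  h.lift (· + c) fun x y h => by simpa [MarkovStep] using h

end MarkovStep

theorem suffZ_sub {n r : ℕ} (x y : (Fin r ↪ Fin n) → ℕ) (p : Fin r × Fin n) :
    suffZ n r (fun σ => (x σ : ℤ) - y σ) p = suffN n r x p - suffN n r y p := by
  simp only [suffZ, suffN]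
  push_cast
  rw [← Finset.sum_sub_distrib]
  exact Finset.sum_congr rfl fun σ _ => by split_ifs <;> simp

theorem suffZ_sub_eq_zero_iff {n r : ℕ} (x y : (Fin r ↪ Fin n) → ℕ) :
    suffZ n r (fun σ => (x σ : ℤ) - y σ) = 0 ↔ suffN n r x = suffN n r y := by
  rw [funext_iff, funext_iff]
  refine forall_congr' fun p => ?_
  rw [suffZ_sub, Pi.zero_apply, sub_eq_zero, Nat.cast_inj]

theorem MarkovStep.suffN_eq {n r : ℕ} {B : Finset ((Fin r ↪ Fin n) → ℤ)}
    (hB : ∀ z ∈ B, suffZ n r z = 0) {x y : (Fin r ↪ Fin n) → ℕ} (h : MarkovStep B x y) :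
    suffN n r x = suffN n r y := by
  rcases h with h | h
  · exact ((suffZ_sub_eq_zero_iff y x).1 (hB _ h)).symm
  · exact (suffZ_sub_eq_zero_iff x y).1 (hB _ h)

theorem isMarkovBasis_iff {n r : ℕ} {B : Finset ((Fin r ↪ Fin n) → ℤ)} :
    IsMarkovBasis n r B ↔ (∀ z ∈ B, suffZ n r z = 0) ∧
      ∀ x y, suffN n r x = suffN n r y → Relation.ReflTransGen (MarkovStep B) x y := by
  refine and_congr_right fun hker => forall₃_congr fun x y hxy => ?_
  constructor
  · rintro ⟨m, w, rfl, rfl, -, hw⟩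
    clear hxy
    induction m with
    | zero => exact .refl
    | succ m ih => exact (ih fun i hi => hw i (by lia)).tail (hw m (by lia))
  · intro h
    clear hxy
    induction h with
    | refl => exact ⟨0, fun _ => x, rfl, rfl, by simp, by simp⟩
    | @tail b c _ hbc ih =>
      obtain ⟨m, w, h0, hm, hfib, hw⟩ := ih
      refine ⟨m + 1, fun i => if i ≤ m then w i else c, by simpa using h0, by simp, ?_, ?_⟩
      · intro i _
        by_cases hi : i ≤ m
        · simpa [hi] using hfib i hi
        · simpa [hi, ← hm, ← hfib m le_rfl] using (hbc.suffN_eq hker).symm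
      · intro i hi
        rcases (Nat.lt_succ_iff.1 hi).lt_or_eq with hi | rfl
        · simpa [hi.le, Nat.succ_le_of_lt hi] using hw i hi
        · simpa [hm, MarkovStep] using hbc

theorem IsMarkovBasis.erase {n r : ℕ} {B : Finset ((Fin r ↪ Fin n) → ℤ)}
    (hB : IsMarkovBasis n r B) {z : (Fin r ↪ Fin n) → ℤ}
    (h : Relation.ReflTransGen (MarkovStep (B.erase z))
      (fun σ => (z σ).toNat) (fun σ => (-z σ).toNat)) :
    IsMarkovBasis n r (B.erase z) := by
  rw [isMarkovBasis_iff] at hB ⊢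
  refine ⟨fun z hz => hB.1 z (Finset.mem_of_mem_erase hz), fun x y hxy => ?_⟩
  have key : ∀ u v : (Fin r ↪ Fin n) → ℕ, (fun σ => (u σ : ℤ) - v σ) = z →
      Relation.ReflTransGen (MarkovStep (B.erase z)) u v := by
    intro u v huv
    have hz : ∀ σ, z σ = u σ - v σ := fun σ => (congrFun huv σ).symm
    convert MarkovStep.reflTransGen_add (fun σ => min (u σ) (v σ)) h using 1 <;>
    · ext σ
      have := hz σ
      simp only [Pi.add_apply]
      lia
  have step : ∀ u v, MarkovStep B u v → Relation.ReflTransGen (MarkovStep (B.erase z)) u v := by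
    rintro u v (huv | huv)
    · by_cases hz : (fun σ => (v σ : ℤ) - u σ) = z
      · exact MarkovStep.reflTransGen_symm (key v u hz)
      · exact .single (.inl (Finset.mem_erase.2 ⟨hz, huv⟩))
    · by_cases hz : (fun σ => (u σ : ℤ) - v σ) = z
      · exact key u v hz
      · exact .single (.inr (Finset.mem_erase.2 ⟨hz, huv⟩))
  have hpath := hB.2 x y hxy
  clear hxy
  induction hpath with
  | refl => exact .refl
  | tail _ hbc ih => exact ih.trans (step _ _ hbc)

open Classical in
/-- The multiplicity function of an unordered pair. -/
noncomputable def pairVec {α : Type*} : Sym2 α → α → ℕ :=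
  Sym2.lift ⟨fun a b => Pi.single a 1 + Pi.single b 1, fun _ _ => add_comm _ _⟩

section pairVec

variable {α : Type*}

open Classical in
theorem pairVec_mk (a b : α) : pairVec s(a, b) = Pi.single a 1 + Pi.single b 1 := rfl

theorem pairVec_ne_zero_iff {p : Sym2 α} {a : α} : pairVec p a ≠ 0 ↔ a ∈ p := by
  classical
  induction p using Sym2.inductionOn with
  | hf b c =>
    simp only [pairVec_mk, Pi.add_apply, Pi.single_apply, Sym2.mem_iff]
    split_ifs <;> simp_all

theorem pairVec_injective : Function.Injective (pairVec (α := α)) := by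
  classical
  intro p q h
  induction p using Sym2.inductionOn with
  | hf a b =>
    have ha : a ∈ q := by
      rw [← pairVec_ne_zero_iff, ← h, pairVec_ne_zero_iff]
      exact Sym2.mem_mk_left a b
    obtain ⟨c, rfl⟩ := Sym2.mem_iff_exists.1 ha
    rw [pairVec_mk, pairVec_mk, add_right_inj] at h
    have := congrFun h b
    simp only [Pi.single_apply, if_true] at this
    split_ifs at this with hbc
    rw [hbc]

theorem sum_pairVec [Fintype α] (p : Sym2 α) : ∑ a, pairVec p a = 2 := by
  classical
  induction p using Sym2.inductionOn with
  | hf a b => simp [pairVec_mk, Finset.sum_add_distrib]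

theorem exists_eq_single_add [Fintype α] [DecidableEq α] {m : ℕ} {x : α → ℕ}
    (hx : ∑ a, x a = m + 1) :
    ∃ (a : α) (y : α → ℕ), ∑ b, y b = m ∧ x = Pi.single a 1 + y := by
  obtain ⟨a, -, ha⟩ := Finset.exists_ne_zero_of_sum_ne_zero (hx.trans_ne m.succ_ne_zero)
  have hxa : x = Pi.single a 1 + (x - Pi.single a 1) := by
    ext b
    rcases eq_or_ne b a with rfl | hb
    · simp
      lia
    · simp [hb]
  refine ⟨a, x - Pi.single a 1, ?_, hxa⟩
  rw [hxa] at hx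
  simp only [Pi.add_apply, Finset.sum_add_distrib, Finset.sum_pi_single', Finset.mem_univ,
    if_true] at hx
  exact Nat.add_left_cancel (hx.trans (add_comm m 1))

theorem exists_pairVec_eq [Fintype α] {x : α → ℕ} (hx : ∑ a, x a = 2) :
    ∃ p, pairVec p = x := by
  classical
  obtain ⟨a, y, hy, rfl⟩ := exists_eq_single_add hx
  obtain ⟨b, w, hw, rfl⟩ := exists_eq_single_add hy
  have hw0 : w = 0 := by
    ext c
    simpa using (Finset.sum_eq_zero_iff.1 hw) c (Finset.mem_univ c)
  exact ⟨s(a, b), by rw [pairVec_mk, hw0, add_zero]⟩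

end pairVec

theorem suffN_pairVec {n r : ℕ} (σ τ : Fin r ↪ Fin n) (j : Fin r) (k : Fin n) :
    suffN n r (pairVec s(σ, τ)) (j, k) = pairVec s(σ j, τ j) k := by
  classical
  have hsingle (σ : Fin r ↪ Fin n) :
      (∑ ρ : Fin r ↪ Fin n, if ρ j = k then (Pi.single σ 1 : (Fin r ↪ Fin n) → ℕ) ρ else 0) =
        (Pi.single (σ j) 1 : Fin n → ℕ) k := by
    rw [Finset.sum_eq_single σ (fun ρ _ h => by simp [h]) (by simp)]
    simp [Pi.single_apply, eq_comm]
  simp only [suffN, pairVec_mk, Pi.add_apply]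
  have h := congrArg₂ (· + ·) (hsingle σ) (hsingle τ)
  simp only [← Finset.sum_add_distrib] at h
  convert h using 2 with ρ
  · split_ifs
    · congr!
    · rfl
  · congr!
  · congr!

theorem suffN_pairVec_eq_iff {n : ℕ} {p q : Sym2 (Fin 3 ↪ Fin n)} :
    suffN n 3 (pairVec p) = suffN n 3 (pairVec q) ↔ coordPairs p = coordPairs q := by
  induction p using Sym2.inductionOn with
  | hf σ τ =>
    induction q using Sym2.inductionOn with
    | hf σ' τ' =>
      have h : suffN n 3 (pairVec s(σ, τ)) = suffN n 3 (pairVec s(σ', τ')) ↔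
          ∀ j, s(σ j, τ j) = s(σ' j, τ' j) := by
        simp only [funext_iff, Prod.forall, suffN_pairVec]
        refine forall_congr' fun j => ?_
        rw [← funext_iff, pairVec_injective.eq_iff]
      rw [h, coordPairs_mk, coordPairs_mk, Prod.mk.injEq, Prod.mk.injEq, Fin.forall_fin_succ,
        Fin.forall_fin_succ, Fin.forall_fin_one]
      rfl

theorem sum_eq_of_suffN_eq {n : ℕ} {x y : (Fin 3 ↪ Fin n) → ℕ} (h : suffN n 3 x = suffN n 3 y) :
    ∑ σ, x σ = ∑ σ, y σ := by
  have hsum (x : (Fin 3 ↪ Fin n) → ℕ) : ∑ k, suffN n 3 x (0, k) = ∑ σ, x σ := by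
    simp only [suffN]
    rw [Finset.sum_comm]
    simp
  rw [← hsum, ← hsum, h]

theorem eq_of_mem_of_coordPairs_eq {n : ℕ} {p q : Sym2 (Fin 3 ↪ Fin n)} {σ : Fin 3 ↪ Fin n}
    (hp : σ ∈ p) (hq : σ ∈ q) (h : coordPairs p = coordPairs q) : p = q := by
  obtain ⟨τ, rfl⟩ := Sym2.mem_iff_exists.1 hp
  obtain ⟨ρ, rfl⟩ := Sym2.mem_iff_exists.1 hq
  simp only [coordPairs_mk, Prod.mk.injEq, Sym2.congr_right] at h
  congr 1
  have : τ = ρ := by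
    ext j
    fin_cases j <;> simp [h]
  rw [this]

/-- The difference of two vectors of degree two. -/
noncomputable def pairMove {α : Type*} (p q : Sym2 α) : α → ℤ := fun σ => pairVec p σ - pairVec q σ

theorem pairVec_eq_zero_or {n : ℕ} {p q : Sym2 (Fin 3 ↪ Fin n)} (hpq : p ≠ q)
    (h : coordPairs p = coordPairs q) (σ : Fin 3 ↪ Fin n) :
    pairVec p σ = 0 ∨ pairVec q σ = 0 := by
  by_contra! hσ
  exact hpq (eq_of_mem_of_coordPairs_eq (pairVec_ne_zero_iff.1 hσ.1) (pairVec_ne_zero_iff.1 hσ.2) h)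

theorem toNat_pairMove {n : ℕ} {p q : Sym2 (Fin 3 ↪ Fin n)} (hpq : p ≠ q)
    (h : coordPairs p = coordPairs q) :
    (fun σ => (pairMove p q σ).toNat) = pairVec p := by
  ext σ
  have := pairVec_eq_zero_or hpq h σ
  simp only [pairMove]
  lia

theorem toNat_neg_pairMove {n : ℕ} {p q : Sym2 (Fin 3 ↪ Fin n)} (hpq : p ≠ q)
    (h : coordPairs p = coordPairs q) :
    (fun σ => (-pairMove p q σ).toNat) = pairVec q := by
  ext σ
  have := pairVec_eq_zero_or hpq h σ
  simp only [pairMove]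
  lia

theorem pairMove_inj {n : ℕ} {p q p' q' : Sym2 (Fin 3 ↪ Fin n)} (hpq : p ≠ q)
    (h : coordPairs p = coordPairs q) (hpq' : p' ≠ q') (h' : coordPairs p' = coordPairs q')
    (heq : pairMove p q = pairMove p' q') : p = p' ∧ q = q' := by
  constructor <;> apply pairVec_injective
  · rw [← toNat_pairMove hpq h, heq, toNat_pairMove hpq' h']
  · rw [← toNat_neg_pairMove hpq h, heq, toNat_neg_pairMove hpq' h']

/-- A move of degree two is the difference of two distinct vectors of degree two. -/
theorem exists_pairMove_eq {n : ℕ} {z : (Fin 3 ↪ Fin n) → ℤ} (hz : suffZ n 3 z = 0)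
    (hdeg : moveDeg n 3 z = 2) : ∃ p q, p ≠ q ∧ pairMove p q = z := by
  have hsub : (fun σ => ((z σ).toNat : ℤ) - (-z σ).toNat) = z := by
    ext σ
    lia
  have hsuff := (suffZ_sub_eq_zero_iff (fun σ => (z σ).toNat) fun σ => (-z σ).toNat).1
    (hsub.symm ▸ hz)
  obtain ⟨p, hp⟩ := exists_pairVec_eq (x := fun σ => (z σ).toNat) hdeg
  obtain ⟨q, hq⟩ := exists_pairVec_eq (x := fun σ => (-z σ).toNat)
    ((sum_eq_of_suffN_eq hsuff).symm.trans hdeg)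
  refine ⟨p, q, ?_, by rw [← hsub]; ext σ; simp only [pairMove, hp, hq]⟩
  rintro rfl
  have hz0 : ∀ σ, (z σ).toNat = 0 := fun σ => by
    have : (z σ).toNat = (-z σ).toNat := congrFun (hp.symm.trans hq) σ
    lia
  simp [moveDeg, hz0] at hdeg

/-- The graph on the vectors of degree two given by the steps of `B`. -/
def stepGraph {α : Type*} (B : Finset (α → ℤ)) : SimpleGraph (Sym2 α) where
  Adj p q := p ≠ q ∧ MarkovStep B (pairVec p) (pairVec q)
  symm := ⟨fun _ _ h => ⟨h.1.symm, h.2.symm⟩⟩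
  loopless := ⟨fun _ h => h.1 rfl⟩

section stepGraph

variable {n : ℕ} {B : Finset ((Fin 3 ↪ Fin n) → ℤ)}

theorem coordPairs_eq_of_adj (hB : IsMarkovBasis n 3 B) {p q : Sym2 (Fin 3 ↪ Fin n)}
    (h : (stepGraph B).Adj p q) : coordPairs p = coordPairs q :=
  suffN_pairVec_eq_iff.1 (h.2.suffN_eq hB.1)

theorem reachable_stepGraph_iff (hB : IsMarkovBasis n 3 B) {p q : Sym2 (Fin 3 ↪ Fin n)} :
    (stepGraph B).Reachable p q ↔ coordPairs p = coordPairs q := by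
  constructor
  · rintro ⟨w⟩
    induction w with
    | nil => rfl
    | cons h _ ih => exact (coordPairs_eq_of_adj hB h).trans ih
  · intro h
    have hpath := (isMarkovBasis_iff.1 hB).2 _ _ (suffN_pairVec_eq_iff.2 h)
    have hreach : ∀ y, Relation.ReflTransGen (MarkovStep B) (pairVec p) y →
        ∃ q', pairVec q' = y ∧ (stepGraph B).Reachable p q' := by
      intro y hy
      induction hy with
      | refl => exact ⟨p, rfl, .refl p⟩
      | @tail b c _ hbc ih =>
        obtain ⟨q', rfl, hq'⟩ := ih
        obtain ⟨q'', rfl⟩ := exists_pairVec_eq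
          ((sum_eq_of_suffN_eq (hbc.suffN_eq hB.1)).symm.trans (sum_pairVec q'))
        refine ⟨q'', rfl, ?_⟩
        rcases eq_or_ne q' q'' with rfl | hne
        · exact hq'
        · exact hq'.trans (SimpleGraph.Adj.reachable ⟨hne, hbc⟩)
    obtain ⟨q', hq', hreach⟩ := hreach _ hpath
    rwa [← pairVec_injective hq']

theorem not_reflTransGen_erase (hB : IsMarkovBasis n 3 B)
    (hmin : ∀ B' ⊂ B, ¬ IsMarkovBasis n 3 B') {p q : Sym2 (Fin 3 ↪ Fin n)} (hpq : p ≠ q)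
    (h : pairMove p q ∈ B) :
    ¬ Relation.ReflTransGen (MarkovStep (B.erase (pairMove p q))) (pairVec p) (pairVec q) := by
  intro hpath
  have hcoord := coordPairs_eq_of_adj hB (p := p) (q := q) ⟨hpq, .inr h⟩
  refine hmin _ (Finset.erase_ssubset h) (hB.erase ?_)
  rwa [toNat_pairMove hpq hcoord, toNat_neg_pairMove hpq hcoord]

theorem stepGraph_isAcyclic (hB : IsMarkovBasis n 3 B)
    (hmin : ∀ B' ⊂ B, ¬ IsMarkovBasis n 3 B') : (stepGraph B).IsAcyclic := by
  rw [SimpleGraph.isAcyclic_iff_forall_adj_isBridge]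
  have key : ∀ p q, p ≠ q → pairMove p q ∈ B → (stepGraph B).IsBridge s(p, q) := by
    rw [forall₂_congr fun p q => forall₂_congr fun _ _ => SimpleGraph.isBridge_iff]
    rintro p q hpq h ⟨w⟩
    have hcoord := coordPairs_eq_of_adj hB (p := p) (q := q) ⟨hpq, .inr h⟩
    refine not_reflTransGen_erase hB hmin hpq h ?_
    have hstep : ∀ u v, ((stepGraph B).deleteEdges {s(p, q)}).Adj u v →
        MarkovStep (B.erase (pairMove p q)) (pairVec u) (pairVec v) := by
      intro u v huv
      rw [SimpleGraph.deleteEdges_adj, Set.mem_singleton_iff] at huv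
      obtain ⟨hadj, hne⟩ := huv
      have hcoord' := coordPairs_eq_of_adj hB hadj
      rcases hadj.2 with hmem | hmem
      · refine .inl (Finset.mem_erase.2 ⟨fun heq => hne ?_, hmem⟩)
        obtain ⟨rfl, rfl⟩ := pairMove_inj hadj.ne.symm hcoord'.symm hpq hcoord heq
        exact Sym2.eq_swap
      · refine .inr (Finset.mem_erase.2 ⟨fun heq => hne ?_, hmem⟩)
        obtain ⟨rfl, rfl⟩ := pairMove_inj hadj.ne hcoord' hpq hcoord heq
        rfl
    clear h hcoord hpq
    generalize B.erase (pairMove p q) = C at hstep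
    generalize (stepGraph B).deleteEdges {s(p, q)} = G at w hstep
    induction w with
    | nil => exact .refl
    | cons h _ ih => exact .head (hstep _ _ h) ih
  rintro p q ⟨hpq, h | h⟩
  · rw [Sym2.eq_swap]
    exact key q p hpq.symm h
  · exact key p q hpq h

theorem card_filter_moveDeg_eq_card_edgeFinset (hn : 3 ≤ n) (hB : IsMarkovBasis n 3 B)
    (hmin : ∀ B' ⊂ B, ¬ IsMarkovBasis n 3 B') [Fintype (stepGraph B).edgeSet] :
    (B.filter fun z => moveDeg n 3 z = 2).card = (stepGraph B).edgeFinset.card := by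
  have hex : ∀ z ∈ B.filter fun z => moveDeg n 3 z = 2,
      ∃ e : Sym2 (Fin 3 ↪ Fin n) × Sym2 (Fin 3 ↪ Fin n), e.1 ≠ e.2 ∧ pairMove e.1 e.2 = z := by
    intro z hz
    rw [Finset.mem_filter] at hz
    obtain ⟨p, q, hpq, rfl⟩ := exists_pairMove_eq (hB.1 z hz.1) hz.2
    exact ⟨(p, q), hpq, rfl⟩
  have : Nonempty (Sym2 (Fin 3 ↪ Fin n)) := ⟨.diag (Fin.castLEEmb hn)⟩
  choose! e hne he using hex
  have hadj : ∀ z ∈ B.filter fun z => moveDeg n 3 z = 2, (stepGraph B).Adj (e z).1 (e z).2 :=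
    fun z hz => ⟨hne z hz, .inr ((congrArg (· ∈ B) (he z hz)).mpr (Finset.mem_filter.1 hz).1)⟩
  refine Finset.card_bij (fun z _ => s((e z).1, (e z).2)) ?_ ?_ ?_
  · intro z hz
    simpa using hadj z hz
  · intro z hz z' hz' heq
    rcases Sym2.eq_iff.1 heq with ⟨h1, h2⟩ | ⟨h1, h2⟩
    · rw [← he z hz, ← he z' hz', h1, h2]
    · exfalso
      have hmem : pairMove (e z).1 (e z).2 ∈ B := (he z hz).symm ▸ (Finset.mem_filter.1 hz).1
      have hmem' : pairMove (e z).2 (e z).1 ∈ B := by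
        rw [h1, h2, he z' hz']
        exact (Finset.mem_filter.1 hz').1
      refine not_reflTransGen_erase hB hmin (hne z hz) hmem
        (.single (.inl (Finset.mem_erase.2 ⟨fun h => hne z hz ?_, hmem'⟩)))
      have hcoord := coordPairs_eq_of_adj hB (hadj z hz)
      exact (pairMove_inj (hne z hz).symm hcoord.symm (hne z hz) hcoord h).2
  · have key : ∀ p q, (stepGraph B).Adj p q → pairMove p q ∈ B →
        ∃ z, ∃ _ : z ∈ B.filter fun z => moveDeg n 3 z = 2, s((e z).1, (e z).2) = s(p, q) := by
      intro p q hadj' hmem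
      have hcoord := coordPairs_eq_of_adj hB hadj'
      have hz : pairMove p q ∈ B.filter fun z => moveDeg n 3 z = 2 := by
        refine Finset.mem_filter.2 ⟨hmem, ?_⟩
        rw [← sum_pairVec p, ← toNat_pairMove hadj'.ne hcoord]
        rfl
      refine ⟨_, hz, ?_⟩
      obtain ⟨h1, h2⟩ := pairMove_inj (hne _ hz) (coordPairs_eq_of_adj hB (hadj _ hz)) hadj'.ne
        hcoord (he _ hz)
      rw [h1, h2]
    intro E hE
    induction E using Sym2.inductionOn with
    | hf p q =>
      rw [SimpleGraph.mem_edgeFinset, SimpleGraph.mem_edgeSet] at hE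
      rcases hE.2 with h | h
      · rw [Sym2.eq_swap]
        exact key q p hE.symm h
      · exact key p q hE h

theorem card_connectedComponent_stepGraph (hB : IsMarkovBasis n 3 B) :
    Nat.card (stepGraph B).ConnectedComponent = Nat.card (Set.range (coordPairs (n := n))) :=
  Nat.card_congr ((Quot.congrRight fun _ _ => reachable_stepGraph_iff hB).trans
    (Setoid.quotientKerEquivRange coordPairs))

end stepGraph

/-- **Every minimal Markov basis for A_{n,3} contains exactly 18·C(n,4) + 270·C(n,5) + 270·C(n,6) moves of degree two.** -/
theorem count_deg_two_moves_r3
    (n : ℕ) (hn : 3 ≤ n)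
    (B : Finset ((Fin 3 ↪ Fin n) → ℤ))
    (hB : IsMarkovBasis n 3 B)
    (hmin : ∀ B' ⊂ B, ¬ IsMarkovBasis n 3 B') :
    (B.filter fun z => moveDeg n 3 z = 2).card = 18 * n.choose 4 + 270 * n.choose 5 + 270 * n.choose 6 := by
  classical
  have hforest := (stepGraph_isAcyclic hB hmin).card_edgeFinset_add_card_connectedComponent
  rw [card_sym2_sub_card_range_coordPairs, ← card_connectedComponent_stepGraph hB,
    Nat.card_eq_fintype_card] at hforest
  rw [card_filter_moveDeg_eq_card_edgeFinset hn hB hmin]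
  lia
end
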